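/- arXiv:2501.00638 — 15 statements merged into one kernel-verified Lean document; each statement's English description precedes it below -/
import Mathlib

section
/- Let n ≥ 1 and let S ⊆ ℝⁿ be a nonempty closed convex set whose recession cone K := rec.cone(S) is pointed (K ∩ (−K) = {0}). Let d be a point in the interior of K with ‖d‖₂ = 1 and set ψ_d := inf { ⟨f, d⟩ : f ∈ K*, ‖f‖₂ = 1 }, where K* is the dual cone of K. Then for every x̂ ∈ S there exists x ∈ S ∩ ℤⁿ such that ‖x − x̂‖₂ ≤ (√n / 2) · (1/ψ_d + 1). In particular S ∩ ℤⁿ is nonempty. -/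
open RealInnerProductSpace

/-- The recession cone of a closed set, as a proper cone. -/
def properRecessionCone {E : Type*} [NormedAddCommGroup E] [InnerProductSpace ℝ E]
    (S : Set E) (hS : IsClosed S) : ProperCone ℝ E where
  carrier := {v | ∀ x ∈ S, ∀ t : ℝ, 0 ≤ t → x + t • v ∈ S}
  add_mem' := by
    intro a b ha hb x hx t ht
    rw [smul_add, ← add_assoc]
    exact hb _ (ha x hx t ht) t ht
  zero_mem' := by
    intro x hx t _
    simpa using hx
  smul_mem' := by
    intro c v hv x hx t ht
    have h := hv x hx (t * c) (mul_nonneg ht c.2)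
    rwa [mul_smul] at h
  isClosed' := by
    simp only [Set.ofPred_forall]
    refine isClosed_iInter fun x => isClosed_iInter fun _ => isClosed_iInter fun t =>
      isClosed_iInter fun _ => hS.preimage (f := fun v => x + t • v) ?_
    fun_prop

namespace ProperCone

variable {E : Type*} [NormedAddCommGroup E] [InnerProductSpace ℝ E] [CompleteSpace E]

/-- A point outside a proper cone is separated from it by a unit dual vector. -/
theorem exists_unit_inner_neg (C : ProperCone ℝ E) {x : E} (hx : x ∉ C) :
    ∃ f : E, (∀ y ∈ C, 0 ≤ ⟪f, y⟫) ∧ ‖f‖ = 1 ∧ ⟪f, x⟫ < 0 := by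
  obtain ⟨g, hg, hgx⟩ := C.hyperplane_separation' hx
  have hg0 : g ≠ 0 := by
    rintro rfl
    simp at hgx
  have hpos : 0 < ‖g‖⁻¹ := inv_pos.2 (norm_pos_iff.2 hg0)
  refine ⟨‖g‖⁻¹ • g, fun y hy => ?_, ?_, ?_⟩
  · rw [real_inner_smul_left, real_inner_comm]
    exact mul_nonneg hpos.le (hg y hy)
  · rw [norm_smul, norm_inv, norm_norm, inv_mul_cancel₀ (norm_ne_zero_iff.2 hg0)]
  · rw [real_inner_smul_left, real_inner_comm]
    exact mul_neg_of_pos_of_neg hpos hgx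

/-- If every unit dual vector is at least `c` on `d`, then the cone contains the closed ball of
radius `c` around `d`. -/
theorem add_mem_of_le_inner (C : ProperCone ℝ E) {d u : E} {c : ℝ}
    (hc : ∀ f : E, (∀ y ∈ C, 0 ≤ ⟪f, y⟫) → ‖f‖ = 1 → c ≤ ⟪f, d⟫) (hu : ‖u‖ ≤ c) :
    d + u ∈ C := by
  by_contra h
  obtain ⟨f, hf, hf1, hneg⟩ := C.exists_unit_inner_neg h
  have h1 := hc f hf hf1
  have h2 := (abs_le.1 (abs_real_inner_le_norm f u)).1
  rw [hf1, one_mul] at h2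
  rw [inner_add_right] at hneg
  linarith

end ProperCone

/-- Unit dual vectors are bounded below by a positive constant on an interior point. -/
theorem exists_pos_le_inner_of_mem_interior {E : Type*} [NormedAddCommGroup E]
    [InnerProductSpace ℝ E] {K : Set E} {d : E} (hd : d ∈ interior K) :
    ∃ c : ℝ, 0 < c ∧ ∀ f : E, (∀ y ∈ K, 0 ≤ ⟪f, y⟫) → ‖f‖ = 1 → c ≤ ⟪f, d⟫ := by
  obtain ⟨c, hc, hball⟩ := Metric.nhds_basis_closedBall.mem_iff.1 (mem_interior_iff_mem_nhds.1 hd)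
  refine ⟨c, hc, fun f hf hf1 => ?_⟩
  have hmem : d - c • f ∈ K := hball <| by
    simp [Metric.mem_closedBall, norm_smul, hf1, abs_of_pos hc]
  have h := hf _ hmem
  rw [inner_sub_right, real_inner_smul_right, real_inner_self_eq_norm_sq, hf1] at h
  linarith

/-- Every point of `ℝⁿ` is within `√n / 2` of an integer point. -/
theorem EuclideanSpace.exists_int_norm_sub_le {n : ℕ} (c : EuclideanSpace ℝ (Fin n)) :
    ∃ x : EuclideanSpace ℝ (Fin n), (∀ i, ∃ m : ℤ, x i = (m : ℝ)) ∧
      ‖x - c‖ ≤ Real.sqrt n / 2 := by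
  refine ⟨WithLp.toLp 2 fun i => (round (c i) : ℝ), fun i => ⟨round (c i), rfl⟩, ?_⟩
  refine abs_le_of_sq_le_sq' ?_ (by positivity) |>.2
  rw [EuclideanSpace.real_norm_sq_eq, div_pow, Real.sq_sqrt n.cast_nonneg]
  calc _ ≤ ∑ _i : Fin n, (1 / 2 : ℝ) ^ 2 := by
        refine Finset.sum_le_sum fun i _ => ?_
        rw [← sq_abs, PiLp.sub_apply, abs_sub_comm]
        exact pow_le_pow_left₀ (abs_nonneg _) (abs_sub_round (c i)) 2
    _ = n / 2 ^ 2 := by simp [div_eq_mul_inv]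

/-- If `S ⊆ ℝⁿ` is a nonempty closed convex set whose recession cone `K`
is pointed, `d` is a unit vector in the interior of `K`, and
`ψ_d := inf { ⟨f, d⟩ : f ∈ K*, ‖f‖ = 1 }`, then for every `x̂ ∈ S` there is an integer
point `x ∈ S ∩ ℤⁿ` with `‖x − x̂‖₂ ≤ (√n / 2) (1/ψ_d + 1)`. -/
theorem stmt1 (n : ℕ) (hn : 1 ≤ n) (S : Set (EuclideanSpace ℝ (Fin n)))
    (hSne : S.Nonempty) (hSclosed : IsClosed S) (hSconvex : Convex ℝ S)
    (K : Set (EuclideanSpace ℝ (Fin n)))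
    (hK : K = {v : EuclideanSpace ℝ (Fin n) | ∀ x ∈ S, ∀ t : ℝ, 0 ≤ t → x + t • v ∈ S})
    (hKpointed : K ∩ (-K) = {0})
    (d : EuclideanSpace ℝ (Fin n)) (hd : d ∈ interior K) (hdnorm : ‖d‖ = 1)
    (ψ : ℝ)
    (hψ : ψ = sInf {t : ℝ | ∃ f : EuclideanSpace ℝ (Fin n),
      (∀ y ∈ K, 0 ≤ ⟪f, y⟫) ∧ ‖f‖ = 1 ∧ t = ⟪f, d⟫}) :
    ∀ xhat ∈ S, ∃ x ∈ S, (∀ i : Fin n, ∃ m : ℤ, x i = (m : ℝ)) ∧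
      ‖x - xhat‖ ≤ (Real.sqrt n / 2) * (1 / ψ + 1) := by
  let C := properRecessionCone S hSclosed
  have hKC : ∀ v, v ∈ K ↔ v ∈ C := fun v => by rw [hK]; rfl
  set T := {t : ℝ | ∃ f : EuclideanSpace ℝ (Fin n),
    (∀ y ∈ K, 0 ≤ ⟪f, y⟫) ∧ ‖f‖ = 1 ∧ t = ⟪f, d⟫} with hT
  obtain ⟨c, hc, hcle⟩ := exists_pos_le_inner_of_mem_interior hd
  have hlower : c ∈ lowerBounds T := by
    rintro _ ⟨f, hf, hf1, rfl⟩
    exact hcle f hf hf1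
  have hne : T.Nonempty := by
    have hnd : -d ∉ C := fun h => by
      have h0 : d ∈ K ∩ -K := ⟨interior_subset hd, (hKC _).2 h⟩
      rw [hKpointed, Set.mem_singleton_iff] at h0
      simp [h0] at hdnorm
    obtain ⟨f, hf, hf1, -⟩ := C.exists_unit_inner_neg hnd
    exact ⟨_, f, fun y hy => hf y ((hKC y).1 hy), hf1, rfl⟩
  have hψpos : 0 < ψ := hc.trans_le (hψ ▸ le_csInf hne hlower)
  have hψle : ∀ f : EuclideanSpace ℝ (Fin n), (∀ y ∈ C, 0 ≤ ⟪f, y⟫) → ‖f‖ = 1 → ψ ≤ ⟪f, d⟫ :=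
    fun f hf hf1 => hψ ▸ csInf_le ⟨c, hlower⟩ ⟨f, fun y hy => hf y ((hKC y).1 hy), hf1, rfl⟩
  intro xhat hxhat
  have hr : 0 < Real.sqrt n / 2 := half_pos (Real.sqrt_pos.2 (by exact_mod_cast hn))
  set r := Real.sqrt n / 2
  have hs : 0 < r / ψ := div_pos hr hψpos
  obtain ⟨x, hxint, hx⟩ := EuclideanSpace.exists_int_norm_sub_le (xhat + (r / ψ) • d)
  set w := x - (xhat + (r / ψ) • d)
  have hxw : x = xhat + (r / ψ) • (d + (r / ψ)⁻¹ • w) := by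
    rw [smul_add, smul_inv_smul₀ hs.ne']
    simp only [w]
    abel
  have hmem : d + (r / ψ)⁻¹ • w ∈ C := by
    refine C.add_mem_of_le_inner hψle ?_
    rw [norm_smul, norm_inv, Real.norm_of_nonneg hs.le, inv_mul_le_iff₀ hs]
    exact hx.trans_eq (div_mul_cancel₀ r hψpos.ne').symm
  refine ⟨x, ?_, hxint, ?_⟩
  · rw [hxw]
    exact hmem xhat hxhat _ hs.le
  · have hsub : x - xhat = (r / ψ) • d + w := by
      simp only [w]
      abel
    calc ‖x - xhat‖ ≤ ‖(r / ψ) • d‖ + ‖w‖ := hsub ▸ norm_add_le _ _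
      _ ≤ r / ψ + r := by
        rw [norm_smul, hdnorm, mul_one, Real.norm_of_nonneg hs.le]
        exact add_le_add_right hx _
      _ = r * (1 / ψ + 1) := by ring
end

section
/- Let n ≥ 1 and let S ⊆ ℝⁿ be a nonempty closed convex set whose recession cone K := rec.cone(S) is pointed. Let d be a point in the interior of K with ‖d‖₂ = 1 and set ψ_d := inf { ⟨f, d⟩ : f ∈ K*, ‖f‖₂ = 1 }, where K* is the dual cone of K. Let α ∈ ℝⁿ be such that the set { ⟨α, x⟩ : x ∈ S } is bounded below. Then S ∩ ℤⁿ is nonempty and inf { ⟨α, x⟩ : x ∈ S ∩ ℤⁿ } − inf { ⟨α, x⟩ : x ∈ S } ≤ ‖α‖₂ · (√n / 2) · (1/ψ_d + 1). -/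
open RealInnerProductSpace

/-- A point outside a closed convex cone is separated from it by a unit vector of the dual cone. -/
theorem exists_unit_dual_inner_neg {E : Type*} [NormedAddCommGroup E] [InnerProductSpace ℝ E]
    [CompleteSpace E] {K : Set E} (hconv : Convex ℝ K) (hclosed : IsClosed K) (hzero : (0 : E) ∈ K)
    (hcone : ∀ y ∈ K, ∀ t : ℝ, 0 ≤ t → t • y ∈ K) {v : E} (hv : v ∉ K) :
    ∃ f : E, (∀ y ∈ K, 0 ≤ ⟪f, y⟫) ∧ ‖f‖ = 1 ∧ ⟪f, v⟫ < 0 := by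
  obtain ⟨φ, u, hφv, hφK⟩ := geometric_hahn_banach_point_closed hconv hclosed hv
  set g : E := (InnerProductSpace.toDual ℝ E).symm φ with hg
  have hφ : ∀ y, ⟪g, y⟫ = φ y := fun y => by simp [hg]
  have hu : u < 0 := by simpa using hφK 0 hzero
  have hgv : ⟪g, v⟫ < 0 := by rw [hφ]; linarith
  have hgK : ∀ y ∈ K, 0 ≤ ⟪g, y⟫ := by
    intro y hy
    by_contra! hneg
    rw [hφ] at hneg
    have h := hφK _ (hcone y hy (u / φ y) (div_nonneg_of_nonpos hu.le hneg.le))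
    rw [map_smul, smul_eq_mul, div_mul_cancel₀ _ hneg.ne] at h
    exact lt_irrefl _ h
  have hg0 : g ≠ 0 := by
    rintro h
    simp [h] at hgv
  have hgpos : 0 < ‖g‖ := norm_pos_iff.mpr hg0
  refine ⟨‖g‖⁻¹ • g, fun y hy => ?_, ?_, ?_⟩
  · rw [real_inner_smul_left]
    exact mul_nonneg (inv_nonneg.mpr hgpos.le) (hgK y hy)
  · rw [norm_smul, norm_inv, norm_norm, inv_mul_cancel₀ hgpos.ne']
  · rw [real_inner_smul_left]
    exact mul_neg_of_pos_of_neg (inv_pos.mpr hgpos) hgv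

/-- Rounding the coordinates moves a point of `ℝⁿ` by at most `√n / 2`. -/
theorem exists_integral_norm_sub_le {n : ℕ} (y : EuclideanSpace ℝ (Fin n)) :
    ∃ z : EuclideanSpace ℝ (Fin n), (∀ i, ∃ m : ℤ, z i = (m : ℝ)) ∧ ‖z - y‖ ≤ √n / 2 := by
  refine ⟨WithLp.toLp 2 fun i => (round (y i) : ℝ), fun i => ⟨round (y i), rfl⟩, ?_⟩
  rw [EuclideanSpace.norm_eq, Real.sqrt_le_left (by positivity), div_pow,
    Real.sq_sqrt (Nat.cast_nonneg n)]
  calc _ ≤ ∑ _i : Fin n, (1 / 4 : ℝ) := by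
        refine Finset.sum_le_sum fun i _ => ?_
        have h := abs_sub_round (y i)
        rw [abs_sub_comm] at h
        calc _ ≤ (1 / 2 : ℝ) ^ 2 := pow_le_pow_left₀ (norm_nonneg _) h 2
          _ = 1 / 4 := by norm_num
    _ = n / 2 ^ 2 := by simp; ring

/-- Under the same hypotheses on `S`, its pointed recession cone `K`, the
interior unit direction `d` and `ψ_d`, if `⟨α, ·⟩` is bounded below on `S`, then
`S ∩ ℤⁿ ≠ ∅` and the integrality gap satisfies
`inf{⟨α,x⟩ : x ∈ S ∩ ℤⁿ} − inf{⟨α,x⟩ : x ∈ S} ≤ ‖α‖₂ (√n/2)(1/ψ_d + 1)`. -/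
theorem stmt2 (n : ℕ) (hn : 1 ≤ n) (S : Set (EuclideanSpace ℝ (Fin n)))
    (hSne : S.Nonempty) (hSclosed : IsClosed S) (hSconvex : Convex ℝ S)
    (K : Set (EuclideanSpace ℝ (Fin n)))
    (hK : K = {v : EuclideanSpace ℝ (Fin n) | ∀ x ∈ S, ∀ t : ℝ, 0 ≤ t → x + t • v ∈ S})
    (hKpointed : K ∩ (-K) = {0})
    (d : EuclideanSpace ℝ (Fin n)) (hd : d ∈ interior K) (hdnorm : ‖d‖ = 1)
    (ψ : ℝ)
    (hψ : ψ = sInf {t : ℝ | ∃ f : EuclideanSpace ℝ (Fin n),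
      (∀ y ∈ K, 0 ≤ ⟪f, y⟫) ∧ ‖f‖ = 1 ∧ t = ⟪f, d⟫})
    (α : EuclideanSpace ℝ (Fin n))
    (hbdd : BddBelow {t : ℝ | ∃ x ∈ S, t = ⟪α, x⟫}) :
    (∃ x ∈ S, ∀ i : Fin n, ∃ m : ℤ, x i = (m : ℝ)) ∧
      sInf {t : ℝ | ∃ x ∈ S, (∀ i : Fin n, ∃ m : ℤ, x i = (m : ℝ)) ∧ t = ⟪α, x⟫} -
        sInf {t : ℝ | ∃ x ∈ S, t = ⟪α, x⟫} ≤
      ‖α‖ * (Real.sqrt n / 2) * (1 / ψ + 1) := by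
  have hmem : ∀ v, v ∈ K ↔ ∀ x ∈ S, ∀ t : ℝ, 0 ≤ t → x + t • v ∈ S := fun v => by rw [hK]; rfl
  have hzero : (0 : EuclideanSpace ℝ (Fin n)) ∈ K := by
    rw [hmem]
    intro x hx t _
    simpa using hx
  have hcone : ∀ y ∈ K, ∀ t : ℝ, 0 ≤ t → t • y ∈ K := by
    intro y hy t ht
    rw [hmem] at hy ⊢
    intro x hx s hs
    rw [smul_smul]
    exact hy x hx _ (mul_nonneg hs ht)
  have hconv : Convex ℝ K := by
    intro v hv w hw a b ha hb _
    rw [hmem] at hv hw ⊢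
    intro x hx t ht
    rw [smul_add, ← add_assoc, smul_smul, smul_smul]
    exact hw _ (hv x hx _ (mul_nonneg ht ha)) _ (mul_nonneg ht hb)
  have hclosed : IsClosed K := by
    rw [hK]
    simp only [Set.ofPred_forall]
    refine isClosed_iInter fun x => isClosed_iInter fun _ => isClosed_iInter fun t =>
      isClosed_iInter fun _ => hSclosed.preimage (by fun_prop)
  have hdK : d ∈ K := interior_subset hd
  have hd0 : d ≠ 0 := by
    rintro rfl
    simp at hdnorm
  have hnegd : -d ∉ K := fun h =>
    hd0 (Set.mem_singleton_iff.mp (hKpointed ▸ (⟨hdK, h⟩ : d ∈ K ∩ -K)))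
  obtain ⟨r, hr, hball⟩ := Metric.nhds_basis_closedBall.mem_iff.mp (mem_interior_iff_mem_nhds.mp hd)
  have hlower : ∀ f : EuclideanSpace ℝ (Fin n), (∀ y ∈ K, 0 ≤ ⟪f, y⟫) → ‖f‖ = 1 → r ≤ ⟪f, d⟫ := by
    intro f hf hf1
    have h := hf (d - r • f) (hball (by
      simp [Metric.mem_closedBall, norm_smul, hf1, abs_of_pos hr]))
    rw [inner_sub_right, real_inner_smul_right, real_inner_self_eq_norm_sq, hf1] at h
    linarith
  have hψpos : 0 < ψ := by
    obtain ⟨f, hf, hf1, -⟩ := exists_unit_dual_inner_neg hconv hclosed hzero hcone hnegd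
    refine hr.trans_le (hψ ▸ le_csInf ⟨_, f, hf, hf1, rfl⟩ ?_)
    rintro t ⟨g, hg, hg1, rfl⟩
    exact hlower g hg hg1
  have hψle : ∀ f : EuclideanSpace ℝ (Fin n), (∀ y ∈ K, 0 ≤ ⟪f, y⟫) → ‖f‖ = 1 → ψ ≤ ⟪f, d⟫ := by
    intro f hf hf1
    rw [hψ]
    refine csInf_le ⟨r, ?_⟩ ⟨f, hf, hf1, rfl⟩
    rintro t ⟨g, hg, hg1, rfl⟩
    exact hlower g hg hg1
  have hψball : ∀ w : EuclideanSpace ℝ (Fin n), ‖w‖ ≤ ψ → d + w ∈ K := by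
    intro w hw
    by_contra hnot
    obtain ⟨f, hf, hf1, hneg⟩ := exists_unit_dual_inner_neg hconv hclosed hzero hcone hnot
    have h1 := hψle f hf hf1
    have h2 := neg_le_of_abs_le (abs_real_inner_le_norm f w)
    rw [hf1, one_mul] at h2
    rw [inner_add_right] at hneg
    linarith
  have hn0 : (0 : ℝ) < √n := Real.sqrt_pos.mpr (by exact_mod_cast hn)
  have hround : ∀ x ∈ S, ∃ z ∈ S, (∀ i : Fin n, ∃ m : ℤ, z i = (m : ℝ)) ∧
      ⟪α, z⟫ ≤ ⟪α, x⟫ + ‖α‖ * (√n / 2) * (1 / ψ + 1) := by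
    intro x hx
    set s : ℝ := √n / 2 / ψ with hs
    have hspos : 0 < s := by positivity
    obtain ⟨z, hzint, hz⟩ := exists_integral_norm_sub_le (x + s • d)
    have hw : ‖s⁻¹ • (z - (x + s • d))‖ ≤ ψ := by
      rw [norm_smul, norm_inv, Real.norm_of_nonneg hspos.le, inv_mul_le_iff₀ hspos, hs,
        div_mul_cancel₀ _ hψpos.ne']
      exact hz
    have hzS := (hmem _).mp (hψball _ hw) x hx s hspos.le
    rw [smul_add, smul_inv_smul₀ hspos.ne', ← add_assoc, add_sub_cancel] at hzS
    refine ⟨z, hzS, hzint, ?_⟩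
    have h1 : ⟪α, z⟫ = ⟪α, x⟫ + s * ⟪α, d⟫ + ⟪α, z - (x + s • d)⟫ := by
      rw [inner_sub_right, inner_add_right, real_inner_smul_right]
      ring
    have h2 : ⟪α, d⟫ ≤ ‖α‖ := by simpa [hdnorm] using real_inner_le_norm α d
    have h3 : ⟪α, z - (x + s • d)⟫ ≤ ‖α‖ * (√n / 2) :=
      (real_inner_le_norm _ _).trans (by gcongr)
    have h4 : s * ⟪α, d⟫ ≤ s * ‖α‖ := by gcongr
    have h5 : ‖α‖ * (√n / 2) * (1 / ψ + 1) = s * ‖α‖ + ‖α‖ * (√n / 2) := by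
      rw [hs]
      ring
    linarith
  obtain ⟨x₀, hx₀⟩ := hSne
  refine ⟨?_, ?_⟩
  · obtain ⟨z, hzS, hzint, -⟩ := hround x₀ hx₀
    exact ⟨z, hzS, hzint⟩
  · rw [sub_le_comm]
    refine le_csInf ⟨_, x₀, hx₀, rfl⟩ ?_
    rintro t ⟨x, hx, rfl⟩
    obtain ⟨z, hzS, hzint, hz⟩ := hround x hx
    have hle : sInf {t : ℝ | ∃ x ∈ S, (∀ i : Fin n, ∃ m : ℤ, x i = (m : ℝ)) ∧ t = ⟪α, x⟫} ≤
        ⟪α, z⟫ := by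
      refine csInf_le (hbdd.mono ?_) ⟨z, hzS, hzint, rfl⟩
      rintro t ⟨y, hy, -, hty⟩
      exact ⟨y, hy, hty⟩
    linarith
end

section
/- Let n ≥ 2, let k ≤ 0 be a real number, and let g ∈ ℝⁿ satisfy ‖ḡ‖₂ < gₙ, where ḡ = (g₁,…,g_{n−1}) (i.e., g lies in the interior of the Lorentz cone). Consider the set Q⁺ = { x ∈ ℝⁿ : x₁² + ⋯ + x_{n−1}² − xₙ² ≤ k and xₙ ≥ 0 }. Then the infimum of ⟨g, x⟩ over x ∈ Q⁺ is attained and equals √( k · (‖ḡ‖₂² − gₙ²) ) (note k ≤ 0 and ‖ḡ‖₂² − gₙ² < 0, so the argument of the square root is nonnegative). -/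
open RealInnerProductSpace

/-- For `n ≥ 2`, `k ≤ 0` and `g = (ḡ, gₙ)` in the interior of the Lorentz
cone (`‖ḡ‖₂ < gₙ`), the infimum of `⟨g, x⟩` over the branch
`Q⁺ = {x = (x̄, xₙ) : ‖x̄‖₂² − xₙ² ≤ k, xₙ ≥ 0}` is attained and equals
`√(k (‖ḡ‖₂² − gₙ²))`. Here `ℝⁿ` is split as `ℝ^{n−1} × ℝ` into the first `n−1`
coordinates and the last one, so `⟨g, x⟩ = ⟨ḡ, x̄⟩ + gₙ xₙ`. -/
theorem stmt5 (n : ℕ) (hn : 2 ≤ n) (k : ℝ) (hk : k ≤ 0)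
    (gbar : EuclideanSpace ℝ (Fin (n - 1))) (gn : ℝ) (hg : ‖gbar‖ < gn) :
    IsLeast {s : ℝ | ∃ (xbar : EuclideanSpace ℝ (Fin (n - 1))) (t : ℝ),
        ‖xbar‖ ^ 2 - t ^ 2 ≤ k ∧ 0 ≤ t ∧ s = ⟪gbar, xbar⟫ + gn * t}
      (Real.sqrt (k * (‖gbar‖ ^ 2 - gn ^ 2))) := by
  have ha : 0 ≤ ‖gbar‖ := norm_nonneg _
  have hD : 0 < gn ^ 2 - ‖gbar‖ ^ 2 := by nlinarith
  constructor
  · have hc0 : 0 ≤ √(-k / (gn ^ 2 - ‖gbar‖ ^ 2)) := Real.sqrt_nonneg _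
    have hc : √(-k / (gn ^ 2 - ‖gbar‖ ^ 2)) ^ 2 * (gn ^ 2 - ‖gbar‖ ^ 2) = -k := by
      rw [Real.sq_sqrt (div_nonneg (by linarith) hD.le), div_mul_cancel₀ _ hD.ne']
    generalize √(-k / (gn ^ 2 - ‖gbar‖ ^ 2)) = c at hc0 hc
    refine ⟨-(c • gbar), c * gn, ?_, mul_nonneg hc0 (ha.trans hg.le), ?_⟩
    · rw [norm_neg, norm_smul, Real.norm_of_nonneg hc0]
      linarith
    · rw [inner_neg_right, real_inner_smul_right, real_inner_self_eq_norm_sq,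
        Real.sqrt_eq_iff_mul_self_eq (by nlinarith) (by nlinarith [mul_nonneg hc0 hD.le])]
      linear_combination -(gn ^ 2 - ‖gbar‖ ^ 2) * hc
  · rintro s ⟨x, t, hx, ht, rfl⟩
    have hr : 0 ≤ ‖x‖ := norm_nonneg _
    have hrt : ‖x‖ ≤ t := abs_le_of_sq_le_sq' (by linarith) ht |>.2
    have hin : -(‖gbar‖ * ‖x‖) ≤ ⟪gbar, x⟫ :=
      neg_le_of_abs_le (abs_real_inner_le_norm gbar x)
    have hle : √(k * (‖gbar‖ ^ 2 - gn ^ 2)) ≤ gn * t - ‖gbar‖ * ‖x‖ := by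
      refine Real.sqrt_le_iff.2 ⟨sub_nonneg.2 (mul_le_mul hg.le hrt hr (ha.trans hg.le)), ?_⟩
      nlinarith [sq_nonneg (‖gbar‖ * t - gn * ‖x‖),
        mul_le_mul_of_nonneg_right hx hD.le]
    linarith
end

section
/- Let M be a real symmetric n×n positive semidefinite matrix, β ∈ ℝⁿ, γ ∈ ℝ, and let Q = { x ∈ ℝⁿ : xᵀMx − 2βᵀx + γ ≤ 0 }. Let uₙ ∈ ℝⁿ with ‖uₙ‖₂ = 1, M uₙ = 0 and βᵀuₙ > 0, and let λ₁ > 0 satisfy vᵀMv ≤ λ₁‖v‖₂² for all v ∈ ℝⁿ. Let x₀ ∈ Q and r > 0. Then for every θ ≥ (r²λ₁ + 2r‖Mx₀ − β‖₂) / (2 βᵀuₙ), the closed Euclidean ball of radius r centered at x₀ + θ·uₙ is contained in Q. -/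
open Matrix

theorem quadratic_add_smul_add {n : ℕ} {M : Matrix (Fin n) (Fin n) ℝ} (hM : M.IsSymm)
    {u : Fin n → ℝ} (hu : M.mulVec u = 0) (β x v : Fin n → ℝ) (θ : ℝ) :
    (x + θ • u + v) ⬝ᵥ M.mulVec (x + θ • u + v) - 2 * (β ⬝ᵥ (x + θ • u + v)) =
      x ⬝ᵥ M.mulVec x - 2 * (β ⬝ᵥ x) + v ⬝ᵥ M.mulVec v + 2 * ((M.mulVec x - β) ⬝ᵥ v)
        - 2 * θ * (β ⬝ᵥ u) := by
  have hswap : ∀ a b : Fin n → ℝ, a ⬝ᵥ M.mulVec b = b ⬝ᵥ M.mulVec a := fun a b => by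
    rw [dotProduct_mulVec, ← mulVec_transpose, hM.eq, dotProduct_comm]
  have hu' : ∀ b : Fin n → ℝ, u ⬝ᵥ M.mulVec b = 0 := fun b => by
    rw [hswap, hu, dotProduct_zero]
  simp only [mulVec_add, mulVec_smul, hu, add_dotProduct, dotProduct_add, smul_dotProduct,
    sub_dotProduct, smul_zero, dotProduct_zero, dotProduct_smul, smul_eq_mul, hu']
  rw [hswap x v, dotProduct_comm (M.mulVec x) v]
  ring

/-- For a positive semidefinite symmetric `M`, the paraboloid
`Q = {x : xᵀMx − 2βᵀx + γ ≤ 0}` with recession direction `uₙ` (`Muₙ = 0`, `βᵀuₙ > 0`,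
`‖uₙ‖₂ = 1`) and `λ₁ > 0` bounding the quadratic form, for `x₀ ∈ Q`, `r > 0` and
`θ ≥ (r²λ₁ + 2r‖Mx₀ − β‖₂)/(2βᵀuₙ)`, the closed ball `B(x₀ + θuₙ, r)` lies in `Q`. -/
theorem stmt6 (n : ℕ) (M : Matrix (Fin n) (Fin n) ℝ) (hMsymm : M.IsSymm)
    (hMpsd : M.PosSemidef)
    (β : EuclideanSpace ℝ (Fin n)) (γ : ℝ)
    (Q : Set (EuclideanSpace ℝ (Fin n)))
    (hQ : Q = {x : EuclideanSpace ℝ (Fin n) | x ⬝ᵥ M.mulVec x - 2 * (β ⬝ᵥ x) + γ ≤ 0})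
    (un : EuclideanSpace ℝ (Fin n)) (hun : ‖un‖ = 1)
    (hMun : M.mulVec un = 0) (hβun : 0 < β ⬝ᵥ un)
    (lam1 : ℝ) (hlam1pos : 0 < lam1)
    (hlam1 : ∀ v : EuclideanSpace ℝ (Fin n), v ⬝ᵥ M.mulVec v ≤ lam1 * ‖v‖ ^ 2)
    (x0 : EuclideanSpace ℝ (Fin n)) (hx0 : x0 ∈ Q) (r : ℝ) (hr : 0 < r) :
    ∀ θ : ℝ,
      (r ^ 2 * lam1 +
          2 * r * ‖(WithLp.equiv 2 (Fin n → ℝ)).symm (M.mulVec x0) - β‖) /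
        (2 * (β ⬝ᵥ un)) ≤ θ →
      Metric.closedBall (x0 + θ • un) r ⊆ Q := by
  intro θ hθ y hy
  subst hQ
  rw [div_le_iff₀ (by positivity)] at hθ
  have hv : ‖y - (x0 + θ • un)‖ ≤ r := mem_closedBall_iff_norm.mp hy
  obtain ⟨v, rfl⟩ : ∃ v, y = x0 + θ • un + v := ⟨y - (x0 + θ • un), by abel⟩
  rw [add_sub_cancel_left] at hv
  set w := (WithLp.equiv 2 (Fin n → ℝ)).symm (M.mulVec x0) - β with hw
  have hquad : v ⬝ᵥ M.mulVec v ≤ lam1 * r ^ 2 := (hlam1 v).trans (by gcongr)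
  have hlin : (M.mulVec x0 - β.ofLp) ⬝ᵥ v ≤ ‖w‖ * r := by
    have hinner : inner ℝ v w = (M.mulVec x0 - β.ofLp) ⬝ᵥ v := by
      simp [hw, EuclideanSpace.inner_eq_star_dotProduct]
    rw [← hinner]
    calc inner ℝ v w ≤ ‖v‖ * ‖w‖ := real_inner_le_norm v w
      _ ≤ r * ‖w‖ := by gcongr
      _ = ‖w‖ * r := mul_comm _ _
  have hexp := quadratic_add_smul_add hMsymm hMun β x0 v θ
  simp only [Set.mem_ofPred_eq, WithLp.ofLp_add, WithLp.ofLp_smul] at hx0 ⊢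
  linarith
end

section
/- Let M be a real symmetric n×n matrix, β ∈ ℝⁿ, γ ∈ ℝ, and let Q = { x ∈ ℝⁿ : xᵀMx − 2βᵀx + γ ≤ 0 }. Let λₙ < 0 and uₙ ∈ ℝⁿ with ‖uₙ‖₂ = 1, M uₙ = λₙ uₙ and βᵀuₙ ≥ 0, and let λ₁ > 0 satisfy vᵀMv ≤ λ₁‖v‖₂² for all v ∈ ℝⁿ. Let x₀ ∈ Q and r > 0, and define Θ₋ := [ −(λₙ x₀ᵀuₙ − βᵀuₙ + r|λₙ|) − √( (λₙ x₀ᵀuₙ − βᵀuₙ + r|λₙ|)² − λₙ (r²λ₁ + 2r‖Mx₀ − β‖₂) ) ] / λₙ. Then for every θ ≥ Θ₋, the closed Euclidean ball of radius r centered at x₀ + θ·uₙ is contained in Q. -/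
open Matrix

theorem EuclideanSpace.abs_dotProduct_le {n : ℕ} (x y : EuclideanSpace ℝ (Fin n)) :
    |x ⬝ᵥ y| ≤ ‖x‖ * ‖y‖ := by
  have h := abs_real_inner_le_norm y x
  rw [EuclideanSpace.inner_eq_star_dotProduct, star_trivial, mul_comm] at h
  exact h

theorem EuclideanSpace.dotProduct_self_eq_norm_sq {n : ℕ} (x : EuclideanSpace ℝ (Fin n)) :
    x ⬝ᵥ x = ‖x‖ ^ 2 := by
  have h := real_inner_self_eq_norm_sq x
  rwa [EuclideanSpace.inner_eq_star_dotProduct, star_trivial] at h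

theorem Matrix.IsSymm.dotProduct_mulVec_comm {n : ℕ} {M : Matrix (Fin n) (Fin n) ℝ}
    (hM : M.IsSymm) (v w : Fin n → ℝ) : v ⬝ᵥ M *ᵥ w = w ⬝ᵥ M *ᵥ v := by
  rw [dotProduct_mulVec, ← mulVec_transpose, hM.eq, dotProduct_comm]

/-- Beyond its largest root, a concave quadratic with nonnegative constant term is nonpositive,
and that root is nonnegative. -/
theorem concave_quadratic_nonpos {a b c t : ℝ} (ha : a < 0) (hc : 0 ≤ c)
    (ht : (-b - √(b ^ 2 - a * c)) / a ≤ t) : 0 ≤ t ∧ a * t ^ 2 + 2 * b * t + c ≤ 0 := by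
  have hac : 0 ≤ -(a * c) := by nlinarith
  have hd : 0 ≤ b ^ 2 - a * c := by nlinarith [sq_nonneg b]
  have hb : |b| ≤ √(b ^ 2 - a * c) := Real.abs_le_sqrt (by linarith)
  have hs := Real.sq_sqrt hd
  set s := √(b ^ 2 - a * c)
  rw [div_le_iff_of_neg ha] at ht
  obtain ⟨hb₁, hb₂⟩ := abs_le.mp hb
  refine ⟨?_, ?_⟩
  · by_contra! h
    nlinarith [mul_pos_of_neg_of_neg ha h]
  · have h : 0 ≤ a * (a * t ^ 2 + 2 * b * t + c) := by nlinarith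
    exact nonpos_of_mul_nonneg_right h ha

/-- For symmetric `M` with negative eigenvalue `λₙ` and unit eigenvector
`uₙ` (`Muₙ = λₙuₙ`, `βᵀuₙ ≥ 0`), `λ₁ > 0` bounding the quadratic form, `x₀` in the
quadratic set `Q = {x : xᵀMx − 2βᵀx + γ ≤ 0}` and `r > 0`, the closed ball
`B(x₀ + θuₙ, r)` is contained in `Q` for every `θ ≥ Θ₋`, where `Θ₋` is the stated
largest root of the associated quadratic. -/
theorem stmt7 (n : ℕ) (M : Matrix (Fin n) (Fin n) ℝ) (hMsymm : M.IsSymm)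
    (β : EuclideanSpace ℝ (Fin n)) (γ : ℝ)
    (Q : Set (EuclideanSpace ℝ (Fin n)))
    (hQ : Q = {x : EuclideanSpace ℝ (Fin n) | x ⬝ᵥ M.mulVec x - 2 * (β ⬝ᵥ x) + γ ≤ 0})
    (lamn : ℝ) (hlamn : lamn < 0)
    (un : EuclideanSpace ℝ (Fin n)) (hun : ‖un‖ = 1)
    (hMun : M.mulVec un = lamn • un) (hβun : 0 ≤ β ⬝ᵥ un)
    (lam1 : ℝ) (hlam1pos : 0 < lam1)
    (hlam1 : ∀ v : EuclideanSpace ℝ (Fin n), v ⬝ᵥ M.mulVec v ≤ lam1 * ‖v‖ ^ 2)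
    (x0 : EuclideanSpace ℝ (Fin n)) (hx0 : x0 ∈ Q) (r : ℝ) (hr : 0 < r)
    (Θ : ℝ)
    (hΘ : Θ = (-(lamn * (x0 ⬝ᵥ un) - β ⬝ᵥ un + r * |lamn|) -
        Real.sqrt ((lamn * (x0 ⬝ᵥ un) - β ⬝ᵥ un + r * |lamn|) ^ 2 -
          lamn * (r ^ 2 * lam1 +
            2 * r * ‖(WithLp.equiv 2 (Fin n → ℝ)).symm (M.mulVec x0) - β‖))) / lamn) :
    ∀ θ : ℝ, Θ ≤ θ → Metric.closedBall (x0 + θ • un) r ⊆ Q := by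
  intro θ hθ x hx
  rw [mem_closedBall_iff_norm] at hx
  obtain ⟨v, rfl⟩ : ∃ v, x = x0 + θ • un + v := ⟨x - (x0 + θ • un), by abel⟩
  rw [add_sub_cancel_left] at hx
  subst hQ
  rw [Set.mem_ofPred_eq] at hx0 ⊢
  set g : EuclideanSpace ℝ (Fin n) := (WithLp.equiv 2 (Fin n → ℝ)).symm (M.mulVec x0) - β with hg
  have hgv := (abs_le.mp (EuclideanSpace.abs_dotProduct_le g v)).2
  have huv := (abs_le.mp (EuclideanSpace.abs_dotProduct_le un v)).1
  have huu := EuclideanSpace.dotProduct_self_eq_norm_sq un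
  have hvv := hlam1 v
  have hgv' : g ⬝ᵥ v = v ⬝ᵥ M *ᵥ x0 - β ⬝ᵥ v := by
    simp [hg, dotProduct_comm]
  rw [hun] at huv huu
  have hsq : ‖v‖ ^ 2 ≤ r ^ 2 := pow_le_pow_left₀ (norm_nonneg v) hx 2
  have hgr : ‖g‖ * ‖v‖ ≤ ‖g‖ * r := mul_le_mul_of_nonneg_left hx (norm_nonneg g)
  have hc : 0 ≤ r ^ 2 * lam1 + 2 * r * ‖g‖ := by positivity
  rw [hΘ] at hθ
  obtain ⟨hθ₀, hq⟩ := concave_quadratic_nonpos hlamn hc hθ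
  rw [abs_of_neg hlamn] at hq
  have hcross : θ * lamn * (un ⬝ᵥ v) ≤ θ * -lamn * r := by
    nlinarith [mul_nonneg hθ₀ (neg_pos.mpr hlamn).le]
  have hvx := hMsymm.dotProduct_mulVec_comm x0 v
  have hux := hMsymm.dotProduct_mulVec_comm un x0
  have huv' := hMsymm.dotProduct_mulVec_comm un v
  have hvu : v ⬝ᵥ un = un ⬝ᵥ v := dotProduct_comm _ _
  simp only [hMun, dotProduct_smul, smul_eq_mul] at hux huv'
  simp only [WithLp.ofLp_add, WithLp.ofLp_smul, mulVec_add, mulVec_smul, hMun, dotProduct_add,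
    add_dotProduct, dotProduct_smul, smul_dotProduct, smul_eq_mul, huu, hux, hvx, huv', hvu]
  nlinarith
end

section
/- Let M be a real symmetric n×n matrix, β ∈ ℝⁿ, γ ∈ ℝ, and let Q = { x ∈ ℝⁿ : xᵀMx − 2βᵀx + γ ≤ 0 }. Let x̂ ∈ Q and set d̂ := M x̂ − β. Let D be a real symmetric positive definite n×n matrix such that D² − M is positive semidefinite. Then the ellipsoid Q̌ := { x ∈ ℝⁿ : ‖D x − (D x̂ − D⁻¹ d̂)‖₂ ≤ ‖D⁻¹ d̂‖₂ } is contained in Q. -/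
open Matrix

/-- Expansion of a quadratic function around the point `a`. -/
theorem quadratic_expand {ι : Type*} [Fintype ι] {M : Matrix ι ι ℝ} (hM : M.IsSymm)
    (b a x : ι → ℝ) (c : ℝ) :
    x ⬝ᵥ M *ᵥ x - 2 * (b ⬝ᵥ x) + c =
      (a ⬝ᵥ M *ᵥ a - 2 * (b ⬝ᵥ a) + c) + 2 * ((M *ᵥ a - b) ⬝ᵥ (x - a)) +
        (x - a) ⬝ᵥ M *ᵥ (x - a) := by
  have h : a ⬝ᵥ M *ᵥ x = x ⬝ᵥ M *ᵥ a := by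
    rw [dotProduct_mulVec, ← mulVec_transpose, hM.eq, dotProduct_comm]
  simp only [mulVec_sub, sub_dotProduct, dotProduct_sub, h, dotProduct_comm (M *ᵥ a)]
  ring

/-- If `D` is symmetric and invertible, membership of `a + u` in the ellipsoid
`‖D u + D⁻¹ d‖ ≤ ‖D⁻¹ d‖` bounds the quadratic form of `D * D` at `u`. -/
theorem quadratic_le_of_ellipsoid {ι : Type*} [Fintype ι] [DecidableEq ι]
    {D : Matrix ι ι ℝ} (hD : D.IsSymm) (hdet : IsUnit D.det) (d u : ι → ℝ)
    (h : (D *ᵥ u + D⁻¹ *ᵥ d) ⬝ᵥ (D *ᵥ u + D⁻¹ *ᵥ d) ≤ (D⁻¹ *ᵥ d) ⬝ᵥ (D⁻¹ *ᵥ d)) :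
    2 * (d ⬝ᵥ u) + u ⬝ᵥ (D * D) *ᵥ u ≤ 0 := by
  have hadj (v w : ι → ℝ) : (D *ᵥ v) ⬝ᵥ w = v ⬝ᵥ D *ᵥ w := by
    rw [dotProduct_mulVec, ← mulVec_transpose, hD.eq]
  have h1 : (D *ᵥ u) ⬝ᵥ (D⁻¹ *ᵥ d) = d ⬝ᵥ u := by
    rw [hadj, mulVec_mulVec, mul_nonsing_inv _ hdet, one_mulVec, dotProduct_comm]
  have h2 : (D *ᵥ u) ⬝ᵥ (D *ᵥ u) = u ⬝ᵥ (D * D) *ᵥ u := by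
    rw [hadj, mulVec_mulVec]
  simp only [add_dotProduct, dotProduct_add, dotProduct_comm (D⁻¹ *ᵥ d) (D *ᵥ u), h1, h2] at h
  linarith

/-- Let `Q = {x : xᵀMx − 2βᵀx + γ ≤ 0}` with `M` symmetric, `x̂ ∈ Q`,
`d̂ = Mx̂ − β`, and let `D` be symmetric positive definite with `D² − M` positive
semidefinite. Then the ellipsoid `Q̌ = {x : ‖Dx − (Dx̂ − D⁻¹d̂)‖₂ ≤ ‖D⁻¹d̂‖₂}` is
contained in `Q`. -/
theorem stmt8 (n : ℕ) (M : Matrix (Fin n) (Fin n) ℝ) (hMsymm : M.IsSymm)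
    (β : EuclideanSpace ℝ (Fin n)) (γ : ℝ)
    (Q : Set (EuclideanSpace ℝ (Fin n)))
    (hQ : Q = {x : EuclideanSpace ℝ (Fin n) | x ⬝ᵥ M.mulVec x - 2 * (β ⬝ᵥ x) + γ ≤ 0})
    (xhat : EuclideanSpace ℝ (Fin n)) (hxhat : xhat ∈ Q)
    (dhat : EuclideanSpace ℝ (Fin n))
    (hdhat : dhat = (WithLp.equiv 2 (Fin n → ℝ)).symm (M.mulVec xhat) - β)
    (D : Matrix (Fin n) (Fin n) ℝ) (hDsymm : D.IsSymm) (hDpd : D.PosDef)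
    (hD2M : (D * D - M).PosSemidef) :
    {x : EuclideanSpace ℝ (Fin n) |
      ‖(WithLp.equiv 2 (Fin n → ℝ)).symm (D.mulVec x) -
        ((WithLp.equiv 2 (Fin n → ℝ)).symm (D.mulVec xhat) -
          (WithLp.equiv 2 (Fin n → ℝ)).symm (D⁻¹.mulVec dhat))‖ ≤
        ‖(WithLp.equiv 2 (Fin n → ℝ)).symm (D⁻¹.mulVec dhat)‖} ⊆ Q := by
  subst hQ hdhat
  intro x hx
  simp only [Set.mem_ofPred_eq] at hx hxhat ⊢
  rw [← sq_le_sq₀ (norm_nonneg _) (norm_nonneg _), EuclideanSpace.real_norm_sq_eq,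
    EuclideanSpace.real_norm_sq_eq] at hx
  have hball := quadratic_le_of_ellipsoid hDsymm hDpd.det_pos.ne'.isUnit
    (M *ᵥ xhat.ofLp - β.ofLp) (x.ofLp - xhat.ofLp) (by
      refine (le_of_eq ?_).trans (hx.trans (le_of_eq ?_))
      · rw [mulVec_sub D, dotProduct]
        refine Finset.sum_congr rfl fun i _ ↦ ?_
        simp only [WithLp.equiv_symm_apply, WithLp.ofLp_sub, Pi.add_apply, Pi.sub_apply]
        ring
      · rw [dotProduct]
        refine Finset.sum_congr rfl fun i _ ↦ ?_
        simp only [WithLp.equiv_symm_apply, WithLp.ofLp_sub, sq])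
  have hpsd := hD2M.dotProduct_mulVec_nonneg (x.ofLp - xhat.ofLp)
  rw [star_trivial, sub_mulVec, dotProduct_sub] at hpsd
  rw [quadratic_expand hMsymm β.ofLp xhat.ofLp]
  linarith
end

section
/- Let A be a real m×n matrix, b ∈ ℝᵐ, c ∈ ℝⁿ and d ∈ ℝ, and let S = { x ∈ ℝⁿ : ‖Ax − b‖₂ ≤ cᵀx − d }. Assume that S is nonempty, that the matrix AᵀA − c cᵀ is positive semidefinite, and that the pair (b, d) does not lie in the image of the stacked linear map x ↦ (Ax, cᵀx), i.e., there is no x ∈ ℝⁿ with Ax = b and cᵀx = d. Then S = { x ∈ ℝⁿ : xᵀ(AᵀA − c cᵀ)x − 2(Aᵀb − d c)ᵀx + bᵀb − d² ≤ 0 }. -/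
open Matrix

/-- Two vectors in the opposite nappes of the second-order cone whose difference is not
in the interior of the cone lie on a common line through the apex. -/
lemma smul_eq_smul_of_sq_sub_le_norm_sq {E : Type*} [NormedAddCommGroup E]
    [InnerProductSpace ℝ E] {u v : E} {s t : ℝ} (hs : 0 < s) (ht : t < 0)
    (hu : ‖u‖ ^ 2 ≤ s ^ 2) (hv : ‖v‖ ^ 2 ≤ t ^ 2)
    (h : (s - t) ^ 2 ≤ ‖u - v‖ ^ 2) : s • v = t • u := by
  have hle : ‖s • v - t • u‖ ^ 2 ≤ 0 := by
    rw [norm_sub_sq_real] at h ⊢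
    rw [norm_smul, norm_smul, mul_pow, mul_pow, Real.norm_eq_abs, Real.norm_eq_abs, sq_abs,
      sq_abs, real_inner_smul_left, real_inner_smul_right, real_inner_comm]
    have hst : 0 < s * -t := mul_pos hs (neg_pos.2 ht)
    nlinarith [mul_le_mul_of_nonneg_left h hst.le,
      mul_le_mul_of_nonneg_left hv (mul_pos hs (by linarith : 0 < s - t)).le,
      mul_le_mul_of_nonneg_left hu (mul_pos (neg_pos.2 ht) (by linarith : 0 < s - t)).le]
  exact sub_eq_zero.1 (norm_eq_zero.1 (pow_eq_zero_iff two_ne_zero |>.1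
    (le_antisymm hle (sq_nonneg _))))

lemma dotProduct_transpose_mul_self_sub_vecMulVec_mulVec {ι κ : Type*} [Fintype ι] [Fintype κ]
    (A : Matrix κ ι ℝ) (c x : ι → ℝ) :
    x ⬝ᵥ (Aᵀ * A - vecMulVec c c).mulVec x =
      A.mulVec x ⬝ᵥ A.mulVec x - (c ⬝ᵥ x) ^ 2 := by
  rw [sub_mulVec, dotProduct_sub, ← mulVec_mulVec, dotProduct_mulVec, vecMul_transpose,
    vecMulVec_mulVec]
  simp [dotProduct_comm x c, sq]

lemma quadratic_representation_eq {ι κ : Type*} [Fintype ι] [Fintype κ]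
    (A : Matrix κ ι ℝ) (b : κ → ℝ) (c x : ι → ℝ) (d : ℝ) :
    x ⬝ᵥ (Aᵀ * A - vecMulVec c c).mulVec x -
        2 * ((Aᵀ.mulVec b - d • c) ⬝ᵥ x) + b ⬝ᵥ b - d ^ 2 =
      (A.mulVec x - b) ⬝ᵥ (A.mulVec x - b) - (c ⬝ᵥ x - d) ^ 2 := by
  rw [dotProduct_transpose_mul_self_sub_vecMulVec_mulVec, sub_dotProduct, mulVec_transpose,
    ← dotProduct_mulVec, smul_dotProduct, sub_dotProduct, dotProduct_sub, dotProduct_sub,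
    dotProduct_comm (A.mulVec x) b, smul_eq_mul]
  ring

lemma norm_toLp_sq {κ : Type*} [Fintype κ] (v : κ → ℝ) :
    ‖WithLp.toLp 2 v‖ ^ 2 = v ⬝ᵥ v := by
  rw [EuclideanSpace.real_norm_sq_eq]
  simp [dotProduct, sq]

/-- If `S = {x : ‖Ax − b‖₂ ≤ cᵀx − d}` is nonempty, `AᵀA − ccᵀ` is positive
semidefinite, and there is no `x` with `Ax = b` and `cᵀx = d`, then
`S = {x : xᵀ(AᵀA − ccᵀ)x − 2(Aᵀb − dc)ᵀx + bᵀb − d² ≤ 0}` (the linear constraint in the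
quadratic representation is redundant). -/
theorem stmt9 (n m : ℕ) (A : Matrix (Fin m) (Fin n) ℝ)
    (b : EuclideanSpace ℝ (Fin m)) (c : EuclideanSpace ℝ (Fin n)) (d : ℝ)
    (S : Set (EuclideanSpace ℝ (Fin n)))
    (hS : S = {x : EuclideanSpace ℝ (Fin n) |
      ‖(WithLp.equiv 2 (Fin m → ℝ)).symm (A.mulVec x) - b‖ ≤ c ⬝ᵥ x - d})
    (hSne : S.Nonempty)
    (hpsd : (Aᵀ * A - vecMulVec c c).PosSemidef)
    (hnoim : ¬ ∃ x : EuclideanSpace ℝ (Fin n), A.mulVec x = b ∧ c ⬝ᵥ x = d) :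
    S = {x : EuclideanSpace ℝ (Fin n) |
      x ⬝ᵥ (Aᵀ * A - vecMulVec c c).mulVec x -
        2 * ((Aᵀ.mulVec (WithLp.equiv 2 (Fin m → ℝ) b) -
          d • WithLp.equiv 2 (Fin n → ℝ) c) ⬝ᵥ x) + b ⬝ᵥ b - d ^ 2 ≤ 0} := by
  have hres : ∀ x : EuclideanSpace ℝ (Fin n),
      ‖(WithLp.equiv 2 (Fin m → ℝ)).symm (A.mulVec x) - b‖ ^ 2 =
        (A.mulVec x - b.ofLp) ⬝ᵥ (A.mulVec x - b.ofLp) := fun x => norm_toLp_sq (A.mulVec x - b.ofLp)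
  have hquad : ∀ x : EuclideanSpace ℝ (Fin n),
      x ⬝ᵥ (Aᵀ * A - vecMulVec c c).mulVec x -
        2 * ((Aᵀ.mulVec (WithLp.equiv 2 (Fin m → ℝ) b) -
          d • WithLp.equiv 2 (Fin n → ℝ) c) ⬝ᵥ x) + b ⬝ᵥ b - d ^ 2 =
      ‖(WithLp.equiv 2 (Fin m → ℝ)).symm (A.mulVec x) - b‖ ^ 2 - (c ⬝ᵥ x - d) ^ 2 :=
    fun x => by rw [hres]; exact quadratic_representation_eq A b c x d
  have hslack : ∀ x : EuclideanSpace ℝ (Fin n),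
      ‖(WithLp.equiv 2 (Fin m → ℝ)).symm (A.mulVec x) - b‖ ^ 2 ≤ (c ⬝ᵥ x - d) ^ 2 →
        c ⬝ᵥ x - d ≠ 0 := by
    intro x hx h0
    rw [h0, hres] at hx
    refine hnoim ⟨x, sub_eq_zero.1 (dotProduct_self_eq_zero.1 (le_antisymm ?_ ?_)),
      sub_eq_zero.1 h0⟩
    · simpa using hx
    · exact hres x ▸ sq_nonneg _
  obtain ⟨y, hy⟩ := hSne
  rw [hS, Set.mem_ofPred_eq] at hy
  have hy2 := pow_le_pow_left₀ (norm_nonneg _) hy 2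
  have hypos : 0 < c ⬝ᵥ y - d := ((norm_nonneg _).trans hy).lt_of_ne' (hslack y hy2)
  rw [hS]
  ext x
  rw [Set.mem_ofPred_eq, Set.mem_ofPred_eq, hquad, sub_nonpos]
  refine ⟨fun h => pow_le_pow_left₀ (norm_nonneg _) h 2, fun hx => ?_⟩
  refine (sq_le_sq₀ (norm_nonneg _) ?_).1 hx
  by_contra! hneg
  have hdiff : ((c ⬝ᵥ y - d) - (c ⬝ᵥ x - d)) ^ 2 ≤
      ‖((WithLp.equiv 2 (Fin m → ℝ)).symm (A.mulVec y) - b) -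
        ((WithLp.equiv 2 (Fin m → ℝ)).symm (A.mulVec x) - b)‖ ^ 2 := by
    have h := hpsd.dotProduct_mulVec_nonneg (y - x : EuclideanSpace ℝ (Fin n))
    rw [star_trivial, dotProduct_transpose_mul_self_sub_vecMulVec_mulVec, sub_nonneg,
      ← norm_toLp_sq, WithLp.ofLp_sub, mulVec_sub, dotProduct_sub] at h
    rw [sub_sub_sub_cancel_right, sub_sub_sub_cancel_right]
    exact h
  have hcol := congrArg WithLp.ofLp (smul_eq_smul_of_sq_sub_le_norm_sq hypos hneg hy2 hx hdiff)
  set s := c ⬝ᵥ y - d with hs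
  set t := c ⬝ᵥ x - d with ht
  clear_value s t
  have hst : s - t ≠ 0 := by linarith
  refine hnoim ⟨(s - t)⁻¹ • (s • x - t • y), ?_, ?_⟩
  · have hcol' : s • (A.mulVec x - b.ofLp) = t • (A.mulVec y - b.ofLp) := hcol
    rw [WithLp.ofLp_smul, mulVec_smul, inv_smul_eq_iff₀ hst]
    rw [WithLp.ofLp_sub, mulVec_sub, WithLp.ofLp_smul, WithLp.ofLp_smul, mulVec_smul,
      mulVec_smul, sub_smul]
    rw [smul_sub, smul_sub] at hcol'
    rw [sub_eq_sub_iff_add_eq_add] at hcol' ⊢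
    rw [hcol', add_comm]
  · rw [WithLp.ofLp_smul, WithLp.ofLp_sub, WithLp.ofLp_smul, WithLp.ofLp_smul,
      dotProduct_smul, dotProduct_sub, dotProduct_smul, dotProduct_smul, smul_eq_mul,
      smul_eq_mul, smul_eq_mul, inv_mul_eq_iff_eq_mul₀ hst,
      show c ⬝ᵥ x = t + d by simp [ht], show c ⬝ᵥ y = s + d by simp [hs]]
    ring
end

section
/- Let Q be a real m×n matrix of rank n, p ∈ ℝᵐ, r > 0, and let S = { x ∈ ℝⁿ : ‖Qx − p‖₂ ≤ r } be the corresponding ellipsoid. Let μ > 0 be such that for every y ∈ ℝⁿ there exists z ∈ ℤⁿ with ‖Q(y − z)‖₂ ≤ μ (i.e., μ is an upper bound on the covering radius of the lattice Qℤⁿ). Assume S ∩ ℤⁿ ≠ ∅, and let x̂ ∈ S satisfy ‖Q x̂ − p‖₂ = r. Then there exists x ∈ S ∩ ℤⁿ with ‖x − x̂‖₂ ≤ 2 · ‖Q (QᵀQ)⁻¹‖ · μ, where ‖Q (QᵀQ)⁻¹‖ denotes the ℓ₂→ℓ₂ operator norm of the matrix Q (QᵀQ)⁻¹. -/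
open Matrix

/-- A point set that is `μ`-dense for the seminorm `‖L ·‖` and meets the ellipsoid
`{x | ‖L x - p‖ ≤ ‖L a - p‖}` meets it within `‖L ·‖`-distance `2 * μ` of the boundary point `a`. -/
theorem exists_mem_norm_map_sub_le_two_mul {E F : Type*} [AddCommGroup E] [Module ℝ E]
    [NormedAddCommGroup F] [InnerProductSpace ℝ F] (L : E →ₗ[ℝ] F)
    [(LinearMap.range L).HasOrthogonalProjection] {Z : Set E} {μ : ℝ} (hμ : 0 < μ)
    (hZ : ∀ y, ∃ z ∈ Z, ‖L (y - z)‖ ≤ μ) {p : F} {a x₀ : E} (hx₀ : x₀ ∈ Z)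
    (hx₀a : ‖L x₀ - p‖ ≤ ‖L a - p‖) :
    ∃ x ∈ Z, ‖L x - p‖ ≤ ‖L a - p‖ ∧ ‖L (x - a)‖ ≤ 2 * μ := by
  obtain ⟨c, hc⟩ : (LinearMap.range L).starProjection p ∈ LinearMap.range L :=
    Submodule.starProjection_apply_mem _ p
  have pythagoras (x : E) : ‖L x - p‖ ^ 2 = ‖L (x - c)‖ ^ 2 + ‖L c - p‖ ^ 2 := by
    have horth : inner ℝ (L (x - c)) (L c - p) = 0 := by
      rw [← neg_sub p, inner_neg_right, hc, real_inner_comm,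
        Submodule.starProjection_inner_eq_zero _ _ (LinearMap.mem_range_self L _), neg_zero]
    have hsplit : L x - p = L (x - c) + (L c - p) := by rw [map_sub]; abel
    rw [hsplit, norm_add_sq_real, horth]
    ring
  have norm_le_iff (x : E) : ‖L x - p‖ ≤ ‖L a - p‖ ↔ ‖L (x - c)‖ ≤ ‖L (a - c)‖ := by
    rw [← sq_le_sq₀ (norm_nonneg _) (norm_nonneg _), pythagoras, pythagoras a,
      add_le_add_iff_right, sq_le_sq₀ (norm_nonneg _) (norm_nonneg _)]
  rcases lt_or_ge ‖L (a - c)‖ μ with hlt | hge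
  · refine ⟨x₀, hx₀, hx₀a, ?_⟩
    have htri : ‖L (x₀ - a)‖ ≤ ‖L (x₀ - c)‖ + ‖L (a - c)‖ := by
      rw [← sub_sub_sub_cancel_right x₀ a c, map_sub L (x₀ - c)]
      exact norm_sub_le _ _
    linarith [(norm_le_iff x₀).1 hx₀a]
  · set R := ‖L (a - c)‖
    have hR : 0 < R := hμ.trans_le hge
    obtain ⟨z, hz, hzμ⟩ := hZ (a - (μ / R) • (a - c))
    have hstep : ‖(μ / R) • L (a - c)‖ = μ := by
      rw [norm_smul, Real.norm_of_nonneg (by positivity), div_mul_cancel₀ _ hR.ne']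
    have hcenter : ‖(1 - μ / R) • L (a - c)‖ = R - μ := by
      rw [norm_smul, Real.norm_of_nonneg (sub_nonneg.2 ((div_le_one hR).2 hge)), sub_mul,
        div_mul_cancel₀ _ hR.ne', one_mul]
    refine ⟨z, hz, (norm_le_iff z).2 ?_, ?_⟩
    · have hsplit : L (z - c) = (1 - μ / R) • L (a - c) - L (a - (μ / R) • (a - c) - z) := by
        simp only [map_sub, map_smul]; module
      rw [hsplit]
      linarith [norm_sub_le ((1 - μ / R) • L (a - c)) (L (a - (μ / R) • (a - c) - z))]
    · have hsplit : L (z - a) = -((μ / R) • L (a - c)) - L (a - (μ / R) • (a - c) - z) := by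
        simp only [map_sub, map_smul]; module
      rw [hsplit]
      have := norm_sub_le (-((μ / R) • L (a - c))) (L (a - (μ / R) • (a - c) - z))
      rw [norm_neg] at this
      linarith

theorem Matrix.isUnit_transpose_mul_self_of_rank_eq {m n : Type*} [Fintype m] [Fintype n]
    [DecidableEq n] {Q : Matrix m n ℝ} (hQ : Q.rank = Fintype.card n) : IsUnit (Qᵀ * Q) := by
  rw [← Matrix.mulVec_injective_iff_isUnit, Matrix.mulVec_injective_iff,
    linearIndependent_iff_card_eq_finrank_span, Set.finrank, ← Matrix.rank_eq_finrank_span_cols,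
    Matrix.rank_transpose_mul_self, hQ]

/-- The norm of the transposed pseudo-inverse of a matrix of full column rank bounds the
distortion of vectors by the matrix from below. -/
theorem Matrix.norm_le_norm_mul_inv_mul_norm {m n : Type*} [Fintype m] [Fintype n]
    [DecidableEq n] {Q : Matrix m n ℝ} (hQ : IsUnit (Qᵀ * Q)) (v : EuclideanSpace ℝ n) :
    ‖v‖ ≤ ‖LinearMap.toContinuousLinearMap (Matrix.toEuclideanLin (Q * (Qᵀ * Q)⁻¹))‖ *
      ‖Matrix.toEuclideanLin Q v‖ := by
  set A := Q * (Qᵀ * Q)⁻¹ with hA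
  have hQA : Qᵀ * A = 1 := by
    rw [hA, ← Matrix.mul_assoc, Matrix.mul_nonsing_inv _ ((Matrix.isUnit_iff_isUnit_det _).1 hQ)]
  have hinner : inner ℝ (Matrix.toEuclideanLin Q v) (Matrix.toEuclideanLin A v) = ‖v‖ ^ 2 := by
    rw [← real_inner_self_eq_norm_sq, EuclideanSpace.inner_eq_star_dotProduct,
      EuclideanSpace.inner_eq_star_dotProduct, Matrix.ofLp_toLpLin, Matrix.ofLp_toLpLin,
      Matrix.toLin'_apply, Matrix.toLin'_apply, star_trivial, star_trivial,
      Matrix.dotProduct_mulVec, ← Matrix.mulVec_transpose, Matrix.mulVec_mulVec, hQA,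
      Matrix.one_mulVec]
  have hCS := real_inner_le_norm (Matrix.toEuclideanLin Q v) (Matrix.toEuclideanLin A v)
  have hop := (LinearMap.toContinuousLinearMap (Matrix.toEuclideanLin A)).le_opNorm v
  rw [LinearMap.coe_toContinuousLinearMap'] at hop
  rcases (norm_nonneg v).eq_or_lt' with hv | hv
  · rw [hv]; positivity
  · refine le_of_mul_le_mul_right ?_ hv
    calc ‖v‖ * ‖v‖ ≤ ‖Matrix.toEuclideanLin Q v‖ * ‖Matrix.toEuclideanLin A v‖ := by
          rw [← sq, ← hinner]; exact hCS
      _ ≤ ‖Matrix.toEuclideanLin Q v‖ *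
          (‖LinearMap.toContinuousLinearMap (Matrix.toEuclideanLin A)‖ * ‖v‖) := by gcongr
      _ = _ := by ring

/-- For the ellipsoid `S = {x : ‖Qx − p‖₂ ≤ r}` (with `Q` of rank `n`),
any upper bound `μ` on the covering radius of the lattice `Qℤⁿ`, and any `x̂ ∈ S` on the
boundary (`‖Qx̂ − p‖₂ = r`), if `S ∩ ℤⁿ ≠ ∅` then there is an integer point `x ∈ S ∩ ℤⁿ`
with `‖x − x̂‖₂ ≤ 2 ‖Q(QᵀQ)⁻¹‖ μ` (ℓ₂→ℓ₂ operator norm). -/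
theorem stmt10 (n m : ℕ) (Q : Matrix (Fin m) (Fin n) ℝ) (hQrank : Q.rank = n)
    (p : EuclideanSpace ℝ (Fin m)) (r : ℝ) (hr : 0 < r)
    (S : Set (EuclideanSpace ℝ (Fin n)))
    (hS : S = {x : EuclideanSpace ℝ (Fin n) |
      ‖(WithLp.equiv 2 (Fin m → ℝ)).symm (Q.mulVec x) - p‖ ≤ r})
    (μ : ℝ) (hμpos : 0 < μ)
    (hμ : ∀ y : Fin n → ℝ, ∃ z : Fin n → ℤ,
      ‖(WithLp.equiv 2 (Fin m → ℝ)).symm (Q.mulVec (y - fun i => (z i : ℝ)))‖ ≤ μ)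
    (hSZ : ∃ x ∈ S, ∀ i : Fin n, ∃ zi : ℤ, x i = (zi : ℝ))
    (xhat : EuclideanSpace ℝ (Fin n)) (hxhatS : xhat ∈ S)
    (hxhatbd : ‖(WithLp.equiv 2 (Fin m → ℝ)).symm (Q.mulVec xhat) - p‖ = r) :
    ∃ x ∈ S, (∀ i : Fin n, ∃ zi : ℤ, x i = (zi : ℝ)) ∧
      ‖x - xhat‖ ≤
        2 * ‖LinearMap.toContinuousLinearMap
              (Matrix.toEuclideanLin (Q * (Qᵀ * Q)⁻¹))‖ * μ := by
  subst hS
  obtain ⟨x₀, hx₀S, hx₀Z⟩ := hSZ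
  have hdense (y : EuclideanSpace ℝ (Fin n)) :
      ∃ z ∈ {x : EuclideanSpace ℝ (Fin n) | ∀ i, ∃ zi : ℤ, x i = zi},
        ‖Matrix.toEuclideanLin Q (y - z)‖ ≤ μ := by
    obtain ⟨z, hz⟩ := hμ y
    exact ⟨WithLp.toLp 2 fun i => (z i : ℝ), fun i => ⟨z i, rfl⟩, hz⟩
  obtain ⟨x, hxZ, hxS, hx⟩ := exists_mem_norm_map_sub_le_two_mul (Matrix.toEuclideanLin Q)
    hμpos hdense (p := p) (a := xhat) hx₀Z (hx₀S.trans_eq hxhatbd.symm)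
  refine ⟨x, hxS.trans_eq hxhatbd, hxZ, ?_⟩
  have hQunit := Matrix.isUnit_transpose_mul_self_of_rank_eq
    (hQrank.trans (Fintype.card_fin n).symm)
  refine (Matrix.norm_le_norm_mul_inv_mul_norm hQunit _).trans ?_
  rw [mul_comm (2 : ℝ), mul_assoc]
  gcongr
end

section
/- Let Q be a real m×n matrix of rank n, p ∈ ℝᵐ, r > 0, and let S = { x ∈ ℝⁿ : ‖Qx − p‖₂ ≤ r } be the corresponding ellipsoid. Let μ > 0 be such that for every y ∈ ℝⁿ there exists z ∈ ℤⁿ with ‖Q(y − z)‖₂ ≤ μ. Assume S ∩ ℤⁿ ≠ ∅ and let α ∈ ℝⁿ. Then inf { ⟨α, x⟩ : x ∈ S ∩ ℤⁿ } − inf { ⟨α, x⟩ : x ∈ S } ≤ 2 · ‖Q (QᵀQ)⁻¹ α‖₂ · μ. -/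
open Matrix RealInnerProductSpace

/-- An affine subspace through `A x₀`, orthogonal to `A x₀ - p`, meets the closed ball of radius `r`
around `p` in the ball of radius `√(r² - ‖A x₀ - p‖²)` around `A x₀`. -/
theorem norm_map_sub_le_iff_of_orthogonal {E F : Type*} [NormedAddCommGroup E]
    [InnerProductSpace ℝ E] [NormedAddCommGroup F] [InnerProductSpace ℝ F] (A : E →ₗ[ℝ] F)
    {p : F} {r : ℝ} (hr : 0 ≤ r) {x₀ : E} (hx₀ : ∀ x, ⟪A x, A x₀ - p⟫ = 0)
    (hd : ‖A x₀ - p‖ ≤ r) (x : E) :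
    ‖A x - p‖ ≤ r ↔ ‖A (x - x₀)‖ ≤ √(r ^ 2 - ‖A x₀ - p‖ ^ 2) := by
  have hd2 : ‖A x₀ - p‖ ^ 2 ≤ r ^ 2 := by gcongr
  have hpyth : ‖A x - p‖ ^ 2 = ‖A (x - x₀)‖ ^ 2 + ‖A x₀ - p‖ ^ 2 := by
    have h : A x - p = A (x - x₀) + (A x₀ - p) := by rw [map_sub]; abel
    rw [h, norm_add_sq_real, hx₀]
    ring
  rw [Real.le_sqrt (norm_nonneg _) (by linarith), ← sq_le_sq₀ (norm_nonneg _) hr, hpyth]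
  constructor <;> intro h <;> linarith

/-- A point of `L` in the ellipsoid `‖A x - p‖ ≤ r` whose value under the functional
`⟪A u, A ·⟫` is within `2 * ‖A u‖ * μ` of every value on the ellipsoid. -/
theorem exists_mem_inner_map_le_add_of_covering {E F : Type*} [NormedAddCommGroup E]
    [InnerProductSpace ℝ E] [NormedAddCommGroup F] [InnerProductSpace ℝ F] (A : E →ₗ[ℝ] F)
    {p : F} {r : ℝ} (hr : 0 ≤ r) {x₀ : E} (hx₀ : ∀ x, ⟪A x, A x₀ - p⟫ = 0) (u : E)
    {L : Set E} {μ : ℝ} (hL : ∀ y, ∃ z ∈ L, ‖A (y - z)‖ ≤ μ)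
    (hne : ∃ x ∈ L, ‖A x - p‖ ≤ r) :
    ∃ x ∈ L, ‖A x - p‖ ≤ r ∧
      ∀ w, ‖A w - p‖ ≤ r → ⟪A u, A x⟫ ≤ ⟪A u, A w⟫ + 2 * ‖A u‖ * μ := by
  obtain ⟨x₁, hx₁L, hx₁⟩ := hne
  have hd : ‖A x₀ - p‖ ≤ r := by
    refine le_trans ?_ hx₁
    rw [← sq_le_sq₀ (norm_nonneg _) (norm_nonneg _)]
    have h : A x₁ - p = A (x₁ - x₀) + (A x₀ - p) := by rw [map_sub]; abel
    rw [h, norm_add_sq_real, hx₀]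
    nlinarith [sq_nonneg ‖A (x₁ - x₀)‖]
  have hiff := norm_map_sub_le_iff_of_orthogonal A hr hx₀ hd
  have hs : 0 ≤ √(r ^ 2 - ‖A x₀ - p‖ ^ 2) := Real.sqrt_nonneg _
  generalize √(r ^ 2 - ‖A x₀ - p‖ ^ 2) = s at hiff hs
  have ha := norm_nonneg (A u)
  have hinner (x : E) : ⟪A u, A x⟫ = ⟪A u, A x₀⟫ + ⟪A u, A (x - x₀)⟫ := by
    rw [← inner_add_right, ← map_add, add_sub_cancel]
  have habs {x : E} {t : ℝ} (hx : ‖A x‖ ≤ t) : |⟪A u, A x⟫| ≤ ‖A u‖ * t :=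
    (abs_real_inner_le_norm _ _).trans (by gcongr)
  simp only [hiff] at hx₁ ⊢
  rcases le_total s μ with hsμ | hsμ
  · refine ⟨x₁, hx₁L, hx₁, fun w hw => ?_⟩
    rw [hinner x₁, hinner w]
    have h₁ := abs_le.1 (habs hx₁)
    have h₂ := abs_le.1 (habs hw)
    nlinarith
  · obtain ⟨z, hzL, hz⟩ := hL (x₀ - ((s - μ) / ‖A u‖) • u)
    have hAz : A (z - x₀) =
        -A (x₀ - ((s - μ) / ‖A u‖) • u - z) - ((s - μ) / ‖A u‖) • A u := by
      simp only [map_sub, map_smul]; abel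
    refine ⟨z, hzL, ?_, fun w hw => ?_⟩
    · rw [hAz]
      refine (norm_sub_le _ _).trans ?_
      rw [norm_neg, norm_smul, Real.norm_of_nonneg (div_nonneg (by linarith) ha)]
      have h : (s - μ) / ‖A u‖ * ‖A u‖ ≤ s - μ := by
        rcases ha.eq_or_lt with h0 | h0
        · rw [← h0]; simpa using hsμ
        · rw [div_mul_cancel₀ _ h0.ne']
      linarith
    · rw [hinner z, hinner w, hAz, inner_sub_right, inner_neg_right, inner_smul_right,
        real_inner_self_eq_norm_sq]
      have h : (s - μ) / ‖A u‖ * ‖A u‖ ^ 2 = (s - μ) * ‖A u‖ := by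
        rcases ha.eq_or_lt with h0 | h0
        · simp [← h0]
        · field_simp
      have h₁ := abs_le.1 (habs hz)
      have h₂ := abs_le.1 (habs hw)
      rw [h]
      linarith

theorem isUnit_det_transpose_mul_self_of_rank_eq {n m : ℕ} (Q : Matrix (Fin m) (Fin n) ℝ)
    (hQ : Q.rank = n) : IsUnit (Qᵀ * Q).det := by
  rw [← Matrix.isUnit_iff_isUnit_det, ← Matrix.mulVec_surjective_iff_isUnit]
  refine (LinearMap.range_eq_top (f := (Qᵀ * Q).mulVecLin)).1 (Submodule.eq_top_of_finrank_eq ?_)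
  exact ((Matrix.rank_transpose_mul_self Q).trans hQ).trans (Module.finrank_fin_fun ℝ).symm

/-- For the ellipsoid `S = {x : ‖Qx − p‖₂ ≤ r}` (with `Q` of rank `n`),
any upper bound `μ` on the covering radius of the lattice `Qℤⁿ`, and `α ∈ ℝⁿ`, if
`S ∩ ℤⁿ ≠ ∅` then the integrality gap satisfies
`inf{⟨α,x⟩ : x ∈ S ∩ ℤⁿ} − inf{⟨α,x⟩ : x ∈ S} ≤ 2 ‖Q(QᵀQ)⁻¹α‖₂ μ`. -/
theorem stmt11 (n m : ℕ) (Q : Matrix (Fin m) (Fin n) ℝ) (hQrank : Q.rank = n)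
    (p : EuclideanSpace ℝ (Fin m)) (r : ℝ) (hr : 0 < r)
    (S : Set (EuclideanSpace ℝ (Fin n)))
    (hS : S = {x : EuclideanSpace ℝ (Fin n) |
      ‖(WithLp.equiv 2 (Fin m → ℝ)).symm (Q.mulVec x) - p‖ ≤ r})
    (μ : ℝ) (hμpos : 0 < μ)
    (hμ : ∀ y : Fin n → ℝ, ∃ z : Fin n → ℤ,
      ‖(WithLp.equiv 2 (Fin m → ℝ)).symm (Q.mulVec (y - fun i => (z i : ℝ)))‖ ≤ μ)
    (hSZ : ∃ x ∈ S, ∀ i : Fin n, ∃ zi : ℤ, x i = (zi : ℝ))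
    (α : EuclideanSpace ℝ (Fin n)) :
    sInf {t : ℝ | ∃ x ∈ S, (∀ i : Fin n, ∃ zi : ℤ, x i = (zi : ℝ)) ∧ t = ⟪α, x⟫} -
      sInf {t : ℝ | ∃ x ∈ S, t = ⟪α, x⟫} ≤
      2 * ‖(WithLp.equiv 2 (Fin m → ℝ)).symm
            (Q.mulVec ((Qᵀ * Q)⁻¹.mulVec (WithLp.equiv 2 (Fin n → ℝ) α)))‖ * μ := by
  have hdet := isUnit_det_transpose_mul_self_of_rank_eq Q hQrank
  subst hS
  have hQ (x : EuclideanSpace ℝ (Fin n)) : (Q.toEuclideanLin x).ofLp = Q *ᵥ x.ofLp := rfl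
  have hdot (x : EuclideanSpace ℝ (Fin n)) (y : EuclideanSpace ℝ (Fin m)) :
      ⟪Q.toEuclideanLin x, y⟫ = x.ofLp ⬝ᵥ (Qᵀ *ᵥ y.ofLp) := by
    rw [EuclideanSpace.inner_eq_star_dotProduct, star_trivial, hQ, dotProduct_comm,
      Matrix.dotProduct_mulVec, Matrix.vecMul_transpose]
  set u : EuclideanSpace ℝ (Fin n) := WithLp.toLp 2 ((Qᵀ * Q)⁻¹ *ᵥ α.ofLp) with hu
  set x₀ : EuclideanSpace ℝ (Fin n) := WithLp.toLp 2 ((Qᵀ * Q)⁻¹ *ᵥ (Qᵀ *ᵥ p.ofLp)) with hx₀_def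
  have hx₀ (x) : ⟪Q.toEuclideanLin x, Q.toEuclideanLin x₀ - p⟫ = 0 := by
    rw [hdot, WithLp.ofLp_sub, Matrix.mulVec_sub, hQ,
      Matrix.mulVec_mulVec, hx₀_def, Matrix.mulVec_mulVec, Matrix.mul_nonsing_inv _ hdet,
      Matrix.one_mulVec, sub_self, dotProduct_zero]
  have hα (x) : ⟪Q.toEuclideanLin u, Q.toEuclideanLin x⟫ = ⟪α, x⟫ := by
    rw [real_inner_comm, hdot, hQ, Matrix.mulVec_mulVec, hu,
      Matrix.mulVec_mulVec, Matrix.mul_nonsing_inv _ hdet, Matrix.one_mulVec,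
      EuclideanSpace.inner_eq_star_dotProduct, star_trivial]
  obtain ⟨x₁, hx₁S, hx₁Z⟩ := hSZ
  obtain ⟨x, hxZ, hxS, hx⟩ := exists_mem_inner_map_le_add_of_covering Q.toEuclideanLin hr.le hx₀ u
    (L := {x | ∀ i, ∃ zi : ℤ, x i = (zi : ℝ)}) (μ := μ)
    (fun y => by
      obtain ⟨z, hz⟩ := hμ y.ofLp
      exact ⟨WithLp.toLp 2 fun i => (z i : ℝ), fun i => ⟨z i, rfl⟩, hz⟩)
    ⟨x₁, hx₁Z, hx₁S⟩
  simp only [hα] at hx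
  have hle : sInf {t : ℝ | ∃ x ∈ {x : EuclideanSpace ℝ (Fin n) |
      ‖(WithLp.equiv 2 (Fin m → ℝ)).symm (Q.mulVec x) - p‖ ≤ r},
      (∀ i : Fin n, ∃ zi : ℤ, x i = (zi : ℝ)) ∧ t = ⟪α, x⟫} ≤ ⟪α, x⟫ := by
    refine csInf_le ⟨⟪α, x⟫ - 2 * ‖Q.toEuclideanLin u‖ * μ, ?_⟩ ⟨x, hxS, hxZ, rfl⟩
    rintro _ ⟨w, hw, -, rfl⟩
    exact sub_le_iff_le_add.2 (hx w hw)
  have hge : ⟪α, x⟫ - 2 * ‖Q.toEuclideanLin u‖ * μ ≤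
      sInf {t : ℝ | ∃ x ∈ {x : EuclideanSpace ℝ (Fin n) |
        ‖(WithLp.equiv 2 (Fin m → ℝ)).symm (Q.mulVec x) - p‖ ≤ r}, t = ⟪α, x⟫} := by
    refine le_csInf ⟨_, x, hxS, rfl⟩ ?_
    rintro _ ⟨w, hw, rfl⟩
    exact sub_le_iff_le_add.2 (hx w hw)
  change _ ≤ 2 * ‖Q.toEuclideanLin u‖ * μ
  linarith
end

section
/- Let n ≥ 1, let M be a real symmetric n×n positive semidefinite matrix, β ∈ ℝⁿ, γ ∈ ℝ, and let S = { x ∈ ℝⁿ : xᵀMx − 2βᵀx + γ ≤ 0 }. Let x̂ ∈ S and suppose w ∈ ℝⁿ is such that x̂ + w + (√n/2)·v ∈ S for every v ∈ ℝⁿ with ‖v‖₂ ≤ 1 (i.e., the closed ball of radius √n/2 centered at x̂ + w is contained in S). Then there exists z ∈ S ∩ ℤⁿ with ‖z − x̂‖₂ ≤ √n/2 + ‖w‖₂. -/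
open Matrix

/-- Every point of `ℝⁿ` lies within distance `√n / 2` of an integer point. -/
theorem exists_integer_point_norm_sub_le {n : ℕ} (c : EuclideanSpace ℝ (Fin n)) :
    ∃ z : EuclideanSpace ℝ (Fin n), (∀ i, ∃ zi : ℤ, z i = (zi : ℝ)) ∧
      ‖z - c‖ ≤ Real.sqrt n / 2 := by
  refine ⟨WithLp.toLp 2 fun i => (round (c i) : ℝ), fun i => ⟨round (c i), rfl⟩, ?_⟩
  rw [EuclideanSpace.norm_eq]
  refine Real.sqrt_le_iff.mpr ⟨by positivity, ?_⟩
  rw [div_pow, Real.sq_sqrt n.cast_nonneg]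
  have h : ∀ i, ‖(round (c i) : ℝ) - c i‖ ^ 2 ≤ (1 / 2) ^ 2 := fun i => by
    gcongr
    rw [norm_sub_rev, Real.norm_eq_abs]
    exact abs_sub_round (c i)
  refine (Finset.sum_le_sum fun i _ => h i).trans_eq ?_
  simp only [Finset.sum_const, Finset.card_univ, Fintype.card_fin, nsmul_eq_mul]
  ring

/-- For the convex quadratic set `S = {x : xᵀMx − 2βᵀx + γ ≤ 0}` (with
`M` symmetric PSD), `x̂ ∈ S`, and `w` such that the closed ball of radius `√n/2`
centered at `x̂ + w` is contained in `S`, there exists an integer point `z ∈ S ∩ ℤⁿ`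
with `‖z − x̂‖₂ ≤ √n/2 + ‖w‖₂`. -/
theorem stmt12 (n : ℕ) (hn : 1 ≤ n)
    (M : Matrix (Fin n) (Fin n) ℝ) (hMsymm : M.IsSymm) (hMpsd : M.PosSemidef)
    (β : EuclideanSpace ℝ (Fin n)) (γ : ℝ)
    (S : Set (EuclideanSpace ℝ (Fin n)))
    (hS : S = {x : EuclideanSpace ℝ (Fin n) | x ⬝ᵥ M.mulVec x - 2 * (β ⬝ᵥ x) + γ ≤ 0})
    (xhat : EuclideanSpace ℝ (Fin n)) (hxhat : xhat ∈ S)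
    (w : EuclideanSpace ℝ (Fin n))
    (hw : ∀ v : EuclideanSpace ℝ (Fin n), ‖v‖ ≤ 1 →
      xhat + w + (Real.sqrt n / 2) • v ∈ S) :
    ∃ z ∈ S, (∀ i : Fin n, ∃ zi : ℤ, z i = (zi : ℝ)) ∧
      ‖z - xhat‖ ≤ Real.sqrt n / 2 + ‖w‖ := by
  obtain ⟨z, hz, hzc⟩ := exists_integer_point_norm_sub_le (xhat + w)
  have hr : 0 < Real.sqrt n / 2 := by
    have : (0 : ℝ) < n := by exact_mod_cast hn
    positivity
  refine ⟨z, ?_, hz, ?_⟩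
  · have h := hw ((Real.sqrt n / 2)⁻¹ • (z - (xhat + w))) ?_
    · rwa [smul_inv_smul₀ hr.ne', add_sub_cancel] at h
    · rw [norm_smul, norm_inv, Real.norm_of_nonneg hr.le]
      exact inv_mul_le_one_of_le₀ hzc hr.le
  · calc
      ‖z - xhat‖ = ‖(z - (xhat + w)) + w‖ := by congr 1; abel
      _ ≤ ‖z - (xhat + w)‖ + ‖w‖ := norm_add_le _ _
      _ ≤ Real.sqrt n / 2 + ‖w‖ := by gcongr
end

section
/- Let n ≥ 1, let M be a real symmetric n×n positive semidefinite matrix, β ∈ ℝⁿ, γ ∈ ℝ, and let S = { x ∈ ℝⁿ : xᵀMx − 2βᵀx + γ ≤ 0 }. Let λ₁ > 0 be such that vᵀMv ≤ λ₁‖v‖₂² for all v ∈ ℝⁿ (i.e., λ₁·I − M is positive semidefinite). Let x̌ be a point of the topological boundary of S, and assume ‖M x̌ − β‖₂ ≥ λ₁ · √n / 2. Then there exists z ∈ S ∩ ℤⁿ with ‖z − x̌‖₂ ≤ √n. -/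
open Matrix

/-- Rounding each coordinate gives an integer point within distance `√n / 2`. -/
theorem exists_int_point_norm_sub_le {n : ℕ} (c : EuclideanSpace ℝ (Fin n)) :
    ∃ z : EuclideanSpace ℝ (Fin n),
      (∀ i, ∃ k : ℤ, z i = (k : ℝ)) ∧ ‖z - c‖ ≤ Real.sqrt n / 2 := by
  refine ⟨WithLp.toLp 2 fun i => (round (c i) : ℝ), fun i => ⟨round (c i), rfl⟩, ?_⟩
  have hsum : ∑ i, ‖(WithLp.toLp 2 (fun i => (round (c i) : ℝ)) - c) i‖ ^ 2 ≤
      ∑ _i : Fin n, ((1 : ℝ) / 2) ^ 2 := by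
    refine Finset.sum_le_sum fun i _ => ?_
    gcongr
    rw [PiLp.sub_apply, Real.norm_eq_abs, abs_sub_comm]
    exact abs_sub_round (c i)
  rw [EuclideanSpace.norm_eq]
  refine Real.sqrt_le_iff.mpr ⟨by positivity, hsum.trans (le_of_eq ?_)⟩
  rw [div_pow _ (2 : ℝ) 2, div_pow (Real.sqrt n), Real.sq_sqrt (Nat.cast_nonneg n)]
  simp
  ring

/-- Second-order expansion of a quadratic function with symmetric matrix. -/
theorem quadratic_add {ι : Type*} [Fintype ι] {M : Matrix ι ι ℝ} (hM : M.IsSymm)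
    (b x w : ι → ℝ) (γ : ℝ) :
    (x + w) ⬝ᵥ M *ᵥ (x + w) - 2 * (b ⬝ᵥ (x + w)) + γ =
      (x ⬝ᵥ M *ᵥ x - 2 * (b ⬝ᵥ x) + γ) + 2 * ((M *ᵥ x - b) ⬝ᵥ w) + w ⬝ᵥ M *ᵥ w := by
  have hcomm : x ⬝ᵥ M *ᵥ w = M *ᵥ x ⬝ᵥ w := by
    rw [dotProduct_mulVec, ← mulVec_transpose, hM.eq]
  simp only [mulVec_add, add_dotProduct, dotProduct_add, sub_dotProduct, hcomm,
    dotProduct_comm w (M *ᵥ x)]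
  ring

/-- For the convex quadratic set `S = {x : xᵀMx − 2βᵀx + γ ≤ 0}` (with
`M` symmetric PSD and `λ₁ > 0` bounding the quadratic form), any boundary point `x̌` of
`S` with `‖Mx̌ − β‖₂ ≥ λ₁√n/2` has an integer point `z ∈ S ∩ ℤⁿ` with `‖z − x̌‖₂ ≤ √n`. -/
theorem stmt13 (n : ℕ) (hn : 1 ≤ n)
    (M : Matrix (Fin n) (Fin n) ℝ) (hMsymm : M.IsSymm) (hMpsd : M.PosSemidef)
    (β : EuclideanSpace ℝ (Fin n)) (γ : ℝ)
    (S : Set (EuclideanSpace ℝ (Fin n)))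
    (hS : S = {x : EuclideanSpace ℝ (Fin n) | x ⬝ᵥ M.mulVec x - 2 * (β ⬝ᵥ x) + γ ≤ 0})
    (lam1 : ℝ) (hlam1pos : 0 < lam1)
    (hlam1 : ∀ v : EuclideanSpace ℝ (Fin n), v ⬝ᵥ M.mulVec v ≤ lam1 * ‖v‖ ^ 2)
    (xc : EuclideanSpace ℝ (Fin n)) (hxc : xc ∈ frontier S)
    (hgrad : lam1 * Real.sqrt n / 2 ≤
      ‖(WithLp.equiv 2 (Fin n → ℝ)).symm (M.mulVec xc) - β‖) :
    ∃ z ∈ S, (∀ i : Fin n, ∃ zi : ℤ, z i = (zi : ℝ)) ∧ ‖z - xc‖ ≤ Real.sqrt n := by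
  set g : EuclideanSpace ℝ (Fin n) :=
    (WithLp.equiv 2 (Fin n → ℝ)).symm (M.mulVec xc) - β with hg
  have hclosed : IsClosed S := by
    rw [hS]
    refine isClosed_le ?_ continuous_const
    simp only [dotProduct, mulVec]
    fun_prop
  have hxcS : xc ∈ S := hclosed.frontier_subset hxc
  rw [hS, Set.mem_ofPred_eq] at hxcS
  have hsqrt : 0 < Real.sqrt n := Real.sqrt_pos.mpr (by exact_mod_cast hn)
  have hgpos : 0 < ‖g‖ := lt_of_lt_of_le (by positivity) hgrad
  set t : ℝ := Real.sqrt n / 2 / ‖g‖ with ht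
  have htpos : 0 < t := by positivity
  have htg : t * ‖g‖ = Real.sqrt n / 2 := div_mul_cancel₀ _ hgpos.ne'
  have hlt : lam1 * t ≤ 1 := by
    rw [ht, ← mul_div_assoc, div_le_one hgpos]
    linarith
  obtain ⟨z, hzint, hz⟩ := exists_int_point_norm_sub_le (xc - t • g)
  set w := z - xc with hw
  have hzw : z - (xc - t • g) = w + t • g := by rw [hw]; abel
  rw [hzw] at hz
  have htgn : ‖t • g‖ = Real.sqrt n / 2 := by
    rw [norm_smul, Real.norm_of_nonneg htpos.le, htg]
  have hinner : ‖w‖ ^ 2 + 2 * t * inner ℝ w g ≤ 0 := by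
    have h := norm_add_sq_real w (t • g)
    rw [inner_smul_right, htgn] at h
    have := pow_le_pow_left₀ (norm_nonneg _) hz 2
    linarith
  refine ⟨z, ?_, hzint, ?_⟩
  · rw [hS, Set.mem_ofPred_eq]
    have hz_eq : z.ofLp = xc.ofLp + w.ofLp := by simp [hw]
    have hdot : (M *ᵥ xc.ofLp - β.ofLp) ⬝ᵥ w.ofLp = inner ℝ w g := by
      simp [hg, EuclideanSpace.inner_eq_star_dotProduct]
    rw [hz_eq, quadratic_add hMsymm, hdot]
    have hquad := hlam1 w
    have hle : inner ℝ w g ≤ 0 := by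
      by_contra! hpos
      have : 0 < 2 * t * inner ℝ w g := by positivity
      linarith [sq_nonneg ‖w‖]
    have hscaled := mul_le_mul_of_nonneg_left hinner hlam1pos.le
    have hslack := mul_nonneg (sub_nonneg.mpr hlt) (neg_nonneg.mpr hle)
    linarith
  · have h := norm_sub_le (w + t • g) (t • g)
    rw [add_sub_cancel_right, htgn] at h
    linarith
end

section
/- Let n ≥ 2. Let M be a real symmetric n×n matrix written in block form M = [[M̄, a],[aᵀ, a₀]] with M̄ of size (n−1)×(n−1), a ∈ ℝ^{n−1}, a₀ ∈ ℝ, and write β = (β̄, βₙ) ∈ ℝ^{n−1} × ℝ, γ ∈ ℝ. Assume M̄ = Q̄ᵀQ̄ for an invertible (n−1)×(n−1) real matrix Q̄, and set q₂ := aᵀM̄⁻¹a − a₀, q₁ := 2(βₙ − β̄ᵀM̄⁻¹a), q₀ := β̄ᵀM̄⁻¹β̄ − γ. Let μ > 0 satisfy: for every y ∈ ℝ^{n−1} there exists z ∈ ℤ^{n−1} with ‖Q̄(y − z)‖₂ ≤ μ. Let S = { x ∈ ℝⁿ : xᵀMx − 2βᵀx + γ ≤ 0 }. Assume q₂ < 0,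 q₁² − 4q₂q₀ ≥ 0, and (q₁² − 4q₂q₀)/(−4q₂) ≥ μ² − q₂/4. Then S ∩ ℤⁿ ≠ ∅ and inf { xₙ : x ∈ S ∩ ℤⁿ } − inf { xₙ : x ∈ S } ≤ ⌈ (−q₁ + √(q₁² − 4q₂(q₀ − μ²))) / (2q₂) ⌉ − (−q₁ + √(q₁² − 4q₂q₀)) / (2q₂) ≤ μ/√(−q₂) + 1. -/
open Matrix

/-- Completing the square in the first block of variables. -/
theorem quadratic_completeSquare {m : Type*} [Fintype m] [DecidableEq m]
    (Q : Matrix m m ℝ) (hQ : IsUnit Q.det) (a b : m → ℝ) (a0 bn γ : ℝ) (x : m → ℝ) (t : ℝ) :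
    x ⬝ᵥ (Qᵀ * Q).mulVec x + 2 * (a ⬝ᵥ x) * t + a0 * t ^ 2 - 2 * (b ⬝ᵥ x + bn * t) + γ =
      Q.mulVec (x - (Qᵀ * Q)⁻¹.mulVec (b - t • a)) ⬝ᵥ
          Q.mulVec (x - (Qᵀ * Q)⁻¹.mulVec (b - t • a)) -
        ((a ⬝ᵥ (Qᵀ * Q)⁻¹.mulVec a - a0) * t ^ 2 +
          2 * (bn - b ⬝ᵥ (Qᵀ * Q)⁻¹.mulVec a) * t + (b ⬝ᵥ (Qᵀ * Q)⁻¹.mulVec b - γ)) := by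
  have hdet : IsUnit (Qᵀ * Q).det := by
    rw [det_mul, det_transpose]
    exact hQ.mul hQ
  obtain ⟨u, rfl⟩ : ∃ u, a = (Qᵀ * Q).mulVec u :=
    ⟨(Qᵀ * Q)⁻¹.mulVec a, by rw [mulVec_mulVec, mul_nonsing_inv _ hdet, one_mulVec]⟩
  obtain ⟨w, rfl⟩ : ∃ w, b = (Qᵀ * Q).mulVec w :=
    ⟨(Qᵀ * Q)⁻¹.mulVec b, by rw [mulVec_mulVec, mul_nonsing_inv _ hdet, one_mulVec]⟩
  have hinv (v : m → ℝ) : (Qᵀ * Q)⁻¹.mulVec ((Qᵀ * Q).mulVec v) = v := by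
    rw [mulVec_mulVec, nonsing_inv_mul _ hdet, one_mulVec]
  have hform (v v' : m → ℝ) : v ⬝ᵥ (Qᵀ * Q).mulVec v' = Q.mulVec v ⬝ᵥ Q.mulVec v' := by
    rw [← mulVec_mulVec, dotProduct_mulVec, vecMul_transpose]
  have hform' (v v' : m → ℝ) : (Qᵀ * Q).mulVec v ⬝ᵥ v' = Q.mulVec v ⬝ᵥ Q.mulVec v' := by
    rw [dotProduct_comm, hform, dotProduct_comm]
  simp only [mulVec_sub, mulVec_smul, hinv, hform, hform', sub_dotProduct, dotProduct_sub,
    smul_dotProduct, dotProduct_smul, smul_eq_mul]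
  rw [dotProduct_comm (Q.mulVec x) (Q.mulVec u), dotProduct_comm (Q.mulVec x) (Q.mulVec w),
    dotProduct_comm (Q.mulVec u) (Q.mulVec w)]
  ring

/-- A concave quadratic is nonnegative only to the right of its smaller root. -/
theorem smaller_root_le {q2 q1 q0 t : ℝ} (hq2 : q2 < 0) (ht : 0 ≤ q2 * t ^ 2 + q1 * t + q0) :
    (-q1 + Real.sqrt (q1 ^ 2 - 4 * q2 * q0)) / (2 * q2) ≤ t := by
  rw [div_le_iff_of_neg (by linarith)]
  have : 2 * q2 * t + q1 ≤ Real.sqrt (q1 ^ 2 - 4 * q2 * q0) :=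
    Real.le_sqrt_of_sq_le (by nlinarith)
  linarith

/-- A concave quadratic whose roots are at distance at least one is nonnegative at the
smallest integer above its smaller root. -/
theorem quadratic_nonneg_ceil_smaller_root {q2 q1 q0 : ℝ} (hq2 : q2 < 0)
    (hD : q2 ^ 2 ≤ q1 ^ 2 - 4 * q2 * q0) :
    0 ≤ q2 * (⌈(-q1 + Real.sqrt (q1 ^ 2 - 4 * q2 * q0)) / (2 * q2)⌉ : ℝ) ^ 2 +
      q1 * (⌈(-q1 + Real.sqrt (q1 ^ 2 - 4 * q2 * q0)) / (2 * q2)⌉ : ℝ) + q0 := by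
  have hs : -q2 ≤ Real.sqrt (q1 ^ 2 - 4 * q2 * q0) := Real.le_sqrt_of_sq_le (by linarith)
  have hsq := Real.sq_sqrt ((sq_nonneg q2).trans hD)
  set s := Real.sqrt (q1 ^ 2 - 4 * q2 * q0)
  have h1 := Int.le_ceil ((-q1 + s) / (2 * q2))
  have h2 := (Int.ceil_lt_add_one ((-q1 + s) / (2 * q2))).le
  generalize (⌈(-q1 + s) / (2 * q2)⌉ : ℝ) = d at h1 h2 ⊢
  rw [div_le_iff_of_neg (by linarith)] at h1
  rw [← sub_le_iff_le_add, le_div_iff_of_neg (by linarith)] at h2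
  have h3 : (2 * q2 * d + q1) ^ 2 ≤ s ^ 2 := sq_le_sq' (by linarith) (by linarith)
  nlinarith

/-- Lowering a concave quadratic by `μ ^ 2` moves its smaller root by at most `μ / √(-q2)`. -/
theorem smaller_root_sub_le {q2 q1 q0 μ : ℝ} (hq2 : q2 < 0) (hμ : 0 ≤ μ)
    (hD : 0 ≤ q1 ^ 2 - 4 * q2 * (q0 - μ ^ 2)) :
    (-q1 + Real.sqrt (q1 ^ 2 - 4 * q2 * (q0 - μ ^ 2))) / (2 * q2) -
      (-q1 + Real.sqrt (q1 ^ 2 - 4 * q2 * q0)) / (2 * q2) ≤ μ / Real.sqrt (-q2) := by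
  have hr : 0 < Real.sqrt (-q2) := Real.sqrt_pos.2 (by linarith)
  have hr2 : Real.sqrt (-q2) ^ 2 = -q2 := Real.sq_sqrt (by linarith)
  have hs := Real.sq_sqrt hD
  have hs0 := Real.sqrt_nonneg (q1 ^ 2 - 4 * q2 * (q0 - μ ^ 2))
  set r := Real.sqrt (-q2)
  set s := Real.sqrt (q1 ^ 2 - 4 * q2 * (q0 - μ ^ 2))
  have hle : Real.sqrt (q1 ^ 2 - 4 * q2 * q0) ≤ s + 2 * r * μ := by
    have : 0 ≤ s * (r * μ) := by positivity
    have hrμ : (r * μ) ^ 2 = -q2 * μ ^ 2 := by rw [mul_pow, hr2]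
    exact Real.sqrt_le_iff.2 ⟨by positivity, by nlinarith⟩
  rw [← sub_div, div_le_iff_of_neg (by linarith)]
  have : μ / r * (2 * q2) = -(2 * r * μ) := by
    rw [show q2 = -r ^ 2 by linarith]
    field_simp
  linarith

/-- ellipsoid case `q₂ < 0`: integrality gap bound for the objective
`xₙ` over the quadratic set defined by the block matrix `M = [[M̄, a],[aᵀ, a₀]]`,
`β = (β̄, βₙ)`, `γ`, where `ℝⁿ` is split as `ℝ^{n−1} × ℝ` and the quadratic form is
written out blockwise: `x̄ᵀM̄x̄ + 2(aᵀx̄)xₙ + a₀xₙ² − 2(β̄ᵀx̄ + βₙxₙ) + γ ≤ 0`. -/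
theorem stmt14 (n : ℕ) (hn : 2 ≤ n)
    (Mbar : Matrix (Fin (n - 1)) (Fin (n - 1)) ℝ) (hMbarSymm : Mbar.IsSymm)
    (a : Fin (n - 1) → ℝ) (a0 : ℝ)
    (βbar : Fin (n - 1) → ℝ) (βn : ℝ) (γ : ℝ)
    (Qbar : Matrix (Fin (n - 1)) (Fin (n - 1)) ℝ) (hQbarInv : IsUnit Qbar.det)
    (hMQ : Mbar = Qbarᵀ * Qbar)
    (q2 q1 q0 : ℝ)
    (hq2 : q2 = a ⬝ᵥ Mbar⁻¹.mulVec a - a0)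
    (hq1 : q1 = 2 * (βn - βbar ⬝ᵥ Mbar⁻¹.mulVec a))
    (hq0 : q0 = βbar ⬝ᵥ Mbar⁻¹.mulVec βbar - γ)
    (μ : ℝ) (hμpos : 0 < μ)
    (hμ : ∀ y : Fin (n - 1) → ℝ, ∃ z : Fin (n - 1) → ℤ,
      ‖(WithLp.equiv 2 (Fin (n - 1) → ℝ)).symm
        (Qbar.mulVec (y - fun i => (z i : ℝ)))‖ ≤ μ)
    (S : Set (EuclideanSpace ℝ (Fin (n - 1)) × ℝ))
    (hS : S = {p : EuclideanSpace ℝ (Fin (n - 1)) × ℝ |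
      p.1 ⬝ᵥ Mbar.mulVec p.1 + 2 * (a ⬝ᵥ p.1) * p.2 + a0 * p.2 ^ 2 -
        2 * (βbar ⬝ᵥ p.1 + βn * p.2) + γ ≤ 0})
    (hq2neg : q2 < 0)
    (hdisc : 0 ≤ q1 ^ 2 - 4 * q2 * q0)
    (hlarge : μ ^ 2 - q2 / 4 ≤ (q1 ^ 2 - 4 * q2 * q0) / (-4 * q2)) :
    (∃ p ∈ S, (∀ i, ∃ zi : ℤ, p.1 i = (zi : ℝ)) ∧ ∃ zn : ℤ, p.2 = (zn : ℝ)) ∧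
      sInf {t : ℝ | ∃ p ∈ S, ((∀ i, ∃ zi : ℤ, p.1 i = (zi : ℝ)) ∧
            (∃ zn : ℤ, p.2 = (zn : ℝ))) ∧ t = p.2} -
        sInf {t : ℝ | ∃ p ∈ S, t = p.2} ≤
        (⌈(-q1 + Real.sqrt (q1 ^ 2 - 4 * q2 * (q0 - μ ^ 2))) / (2 * q2)⌉ : ℝ) -
          (-q1 + Real.sqrt (q1 ^ 2 - 4 * q2 * q0)) / (2 * q2) ∧
      (⌈(-q1 + Real.sqrt (q1 ^ 2 - 4 * q2 * (q0 - μ ^ 2))) / (2 * q2)⌉ : ℝ) -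
          (-q1 + Real.sqrt (q1 ^ 2 - 4 * q2 * q0)) / (2 * q2) ≤
        μ / Real.sqrt (-q2) + 1 := by
  subst hMQ
  have hS_iff (x : EuclideanSpace ℝ (Fin (n - 1))) (t : ℝ) : (x, t) ∈ S ↔
      ‖(WithLp.equiv 2 (Fin (n - 1) → ℝ)).symm
        (Qbar.mulVec ((Qbarᵀ * Qbar)⁻¹.mulVec (βbar - t • a) - x.ofLp))‖ ^ 2 ≤
        q2 * t ^ 2 + q1 * t + q0 := by
    rw [hS, Set.mem_ofPred_eq, quadratic_completeSquare Qbar hQbarInv, ← hq2, ← hq1, ← hq0,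
      sub_nonpos, ← neg_sub x.ofLp, mulVec_neg, EuclideanSpace.real_norm_sq_eq]
    simp [dotProduct, sq]
  have hlower {x : EuclideanSpace ℝ (Fin (n - 1))} {t : ℝ} (h : (x, t) ∈ S) :
      (-q1 + Real.sqrt (q1 ^ 2 - 4 * q2 * q0)) / (2 * q2) ≤ t :=
    smaller_root_le hq2neg ((sq_nonneg _).trans ((hS_iff x t).1 h))
  have hD : q2 ^ 2 ≤ q1 ^ 2 - 4 * q2 * (q0 - μ ^ 2) := by
    rw [le_div_iff₀ (by linarith)] at hlarge
    linarith
  have hceil := quadratic_nonneg_ceil_smaller_root hq2neg hD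
  have hroot := smaller_root_sub_le hq2neg hμpos.le ((sq_nonneg q2).trans hD)
  have hlt := Int.ceil_lt_add_one
    ((-q1 + Real.sqrt (q1 ^ 2 - 4 * q2 * (q0 - μ ^ 2))) / (2 * q2))
  set δ := ⌈(-q1 + Real.sqrt (q1 ^ 2 - 4 * q2 * (q0 - μ ^ 2))) / (2 * q2)⌉
  obtain ⟨z, hz⟩ := hμ ((Qbarᵀ * Qbar)⁻¹.mulVec (βbar - (δ : ℝ) • a))
  have hmem : ((WithLp.toLp 2 fun i => (z i : ℝ) : EuclideanSpace ℝ (Fin (n - 1))), (δ : ℝ)) ∈ S :=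
    (hS_iff _ _).2 ((pow_le_pow_left₀ (norm_nonneg _) hz 2).trans (by linarith))
  refine ⟨⟨_, hmem, fun i => ⟨z i, rfl⟩, δ, rfl⟩, sub_le_sub ?_ ?_, by linarith⟩
  · refine csInf_le ⟨(-q1 + Real.sqrt (q1 ^ 2 - 4 * q2 * q0)) / (2 * q2), ?_⟩
      ⟨_, hmem, ⟨fun i => ⟨z i, rfl⟩, δ, rfl⟩, rfl⟩
    rintro _ ⟨p, hp, -, rfl⟩
    exact hlower hp
  · refine le_csInf ⟨_, _, hmem, rfl⟩ ?_
    rintro _ ⟨p, hp, rfl⟩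
    exact hlower hp
end

section
/- Let n ≥ 2. Let M be a real symmetric n×n matrix written in block form M = [[M̄, a],[aᵀ, a₀]] with M̄ of size (n−1)×(n−1), a ∈ ℝ^{n−1}, a₀ ∈ ℝ, and write β = (β̄, βₙ) ∈ ℝ^{n−1} × ℝ, γ ∈ ℝ. Assume M̄ = Q̄ᵀQ̄ for an invertible (n−1)×(n−1) real matrix Q̄, and set q₂ := aᵀM̄⁻¹a − a₀, q₁ := 2(βₙ − β̄ᵀM̄⁻¹a), q₀ := β̄ᵀM̄⁻¹β̄ − γ. Let μ > 0 satisfy: for every y ∈ ℝ^{n−1} there exists z ∈ ℤ^{n−1} with ‖Q̄(y − z)‖₂ ≤ μ. Let S = { x ∈ ℝⁿ : xᵀMx − 2βᵀx + γ ≤ 0 }. Assume q₂ = 0 and q₁ > 0. Then S ∩ ℤⁿ ≠ ∅ and inf { xₙ : x ∈ S ∩ ℤⁿ } − inf { xₙ : x ∈ S } ≤ ⌈ (μ² − q₀)/q₁ ⌉ + q₀/q₁ ≤ μ²/q₁ + 1. -/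
open Matrix

/-- Completing the square in the first block of a block quadratic form. -/
lemma block_quadratic_eq_completed_square {m : Type*} [Fintype m] [DecidableEq m]
    {M : Matrix m m ℝ} (hM : M.IsSymm) (hdet : IsUnit M.det) (a β x : m → ℝ) (t : ℝ) :
    x ⬝ᵥ M *ᵥ x + 2 * (a ⬝ᵥ x) * t + (a ⬝ᵥ M⁻¹ *ᵥ a) * t ^ 2 - 2 * (β ⬝ᵥ x) =
      (x + t • M⁻¹ *ᵥ a - M⁻¹ *ᵥ β) ⬝ᵥ M *ᵥ (x + t • M⁻¹ *ᵥ a - M⁻¹ *ᵥ β) +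
        2 * t * (β ⬝ᵥ M⁻¹ *ᵥ a) - β ⬝ᵥ M⁻¹ *ᵥ β := by
  have hinv (v : m → ℝ) : M *ᵥ (M⁻¹ *ᵥ v) = v := by
    rw [mulVec_mulVec, mul_nonsing_inv _ hdet, one_mulVec]
  have hsymm (u v : m → ℝ) : u ⬝ᵥ M *ᵥ v = v ⬝ᵥ M *ᵥ u := by
    rw [dotProduct_mulVec, ← mulVec_transpose, hM.eq, dotProduct_comm]
  have hcross (u v : m → ℝ) : (M⁻¹ *ᵥ u) ⬝ᵥ M *ᵥ v = u ⬝ᵥ v := by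
    rw [hsymm, hinv, dotProduct_comm]
  have hswap : a ⬝ᵥ M⁻¹ *ᵥ β = β ⬝ᵥ M⁻¹ *ᵥ a := by
    rw [← hcross, hinv, dotProduct_comm]
  simp only [mulVec_add, mulVec_sub, mulVec_smul, hinv, dotProduct_add, dotProduct_sub,
    dotProduct_smul, add_dotProduct, sub_dotProduct, smul_dotProduct, hcross, smul_eq_mul]
  rw [dotProduct_comm x a, dotProduct_comm x β, dotProduct_comm (M⁻¹ *ᵥ a) a,
    dotProduct_comm (M⁻¹ *ᵥ β) a, dotProduct_comm (M⁻¹ *ᵥ a) β,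
    dotProduct_comm (M⁻¹ *ᵥ β) β, hswap]
  ring

lemma dotProduct_transpose_mul_self_mulVec {m : Type*} [Fintype m]
    (Q : Matrix m m ℝ) (w : m → ℝ) :
    w ⬝ᵥ (Qᵀ * Q) *ᵥ w = ‖WithLp.toLp 2 (Q *ᵥ w)‖ ^ 2 := by
  rw [← mulVec_mulVec, dotProduct_mulVec, vecMul_transpose, EuclideanSpace.real_norm_sq_eq]
  simp [dotProduct, sq]

/-- paraboloid case `q₂ = 0`, `q₁ > 0`: integrality gap bound for the
objective `xₙ` over the quadratic set defined by the block matrix `M = [[M̄, a],[aᵀ, a₀]]`,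
`β = (β̄, βₙ)`, `γ`, where `ℝⁿ` is split as `ℝ^{n−1} × ℝ` and the quadratic form is
written out blockwise. -/
theorem stmt15 (n : ℕ) (hn : 2 ≤ n)
    (Mbar : Matrix (Fin (n - 1)) (Fin (n - 1)) ℝ) (hMbarSymm : Mbar.IsSymm)
    (a : Fin (n - 1) → ℝ) (a0 : ℝ)
    (βbar : Fin (n - 1) → ℝ) (βn : ℝ) (γ : ℝ)
    (Qbar : Matrix (Fin (n - 1)) (Fin (n - 1)) ℝ) (hQbarInv : IsUnit Qbar.det)
    (hMQ : Mbar = Qbarᵀ * Qbar)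
    (q2 q1 q0 : ℝ)
    (hq2 : q2 = a ⬝ᵥ Mbar⁻¹.mulVec a - a0)
    (hq1 : q1 = 2 * (βn - βbar ⬝ᵥ Mbar⁻¹.mulVec a))
    (hq0 : q0 = βbar ⬝ᵥ Mbar⁻¹.mulVec βbar - γ)
    (μ : ℝ) (hμpos : 0 < μ)
    (hμ : ∀ y : Fin (n - 1) → ℝ, ∃ z : Fin (n - 1) → ℤ,
      ‖(WithLp.equiv 2 (Fin (n - 1) → ℝ)).symm
        (Qbar.mulVec (y - fun i => (z i : ℝ)))‖ ≤ μ)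
    (S : Set (EuclideanSpace ℝ (Fin (n - 1)) × ℝ))
    (hS : S = {p : EuclideanSpace ℝ (Fin (n - 1)) × ℝ |
      p.1 ⬝ᵥ Mbar.mulVec p.1 + 2 * (a ⬝ᵥ p.1) * p.2 + a0 * p.2 ^ 2 -
        2 * (βbar ⬝ᵥ p.1 + βn * p.2) + γ ≤ 0})
    (hq2zero : q2 = 0) (hq1pos : 0 < q1) :
    (∃ p ∈ S, (∀ i, ∃ zi : ℤ, p.1 i = (zi : ℝ)) ∧ ∃ zn : ℤ, p.2 = (zn : ℝ)) ∧
      sInf {t : ℝ | ∃ p ∈ S, ((∀ i, ∃ zi : ℤ, p.1 i = (zi : ℝ)) ∧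
            (∃ zn : ℤ, p.2 = (zn : ℝ))) ∧ t = p.2} -
        sInf {t : ℝ | ∃ p ∈ S, t = p.2} ≤
        (⌈(μ ^ 2 - q0) / q1⌉ : ℝ) + q0 / q1 ∧
      (⌈(μ ^ 2 - q0) / q1⌉ : ℝ) + q0 / q1 ≤ μ ^ 2 / q1 + 1 := by
  have hdet : IsUnit Mbar.det := by
    rw [hMQ, det_mul, det_transpose]
    exact hQbarInv.mul hQbarInv
  have ha0 : a0 = a ⬝ᵥ Mbar⁻¹ *ᵥ a := by linarith
  have mem_S (p : EuclideanSpace ℝ (Fin (n - 1)) × ℝ) : p ∈ S ↔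
      ‖WithLp.toLp 2 (Qbar *ᵥ (p.1.ofLp + p.2 • Mbar⁻¹ *ᵥ a - Mbar⁻¹ *ᵥ βbar))‖ ^ 2 ≤
        q1 * p.2 + q0 := by
    have hsq := block_quadratic_eq_completed_square hMbarSymm hdet a βbar p.1.ofLp p.2
    have hnorm := dotProduct_transpose_mul_self_mulVec Qbar
      (p.1.ofLp + p.2 • Mbar⁻¹ *ᵥ a - Mbar⁻¹ *ᵥ βbar)
    rw [← hMQ] at hnorm
    rw [hS, Set.mem_ofPred_eq, ha0, hq1, hq0, ← hnorm]
    constructor <;> intro h <;> linarith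
  have lower_bound (p) (hp : p ∈ S) : -(q0 / q1) ≤ p.2 := by
    rw [← neg_div, div_le_iff₀ hq1pos]
    nlinarith [(mem_S p).1 hp,
      sq_nonneg ‖WithLp.toLp 2 (Qbar *ᵥ (p.1.ofLp + p.2 • Mbar⁻¹ *ᵥ a - Mbar⁻¹ *ᵥ βbar))‖]
  set N : ℤ := ⌈(μ ^ 2 - q0) / q1⌉ with hN
  obtain ⟨z, hz⟩ := hμ (Mbar⁻¹ *ᵥ βbar - (N : ℝ) • Mbar⁻¹ *ᵥ a)
  have hmem : ((WithLp.toLp 2 fun i => (z i : ℝ), (N : ℝ)) :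
      EuclideanSpace ℝ (Fin (n - 1)) × ℝ) ∈ S := by
    rw [mem_S]
    have hneg : (fun i => (z i : ℝ)) + (N : ℝ) • Mbar⁻¹ *ᵥ a - Mbar⁻¹ *ᵥ βbar =
        -(Mbar⁻¹ *ᵥ βbar - (N : ℝ) • Mbar⁻¹ *ᵥ a - fun i => (z i : ℝ)) := by
      abel
    have hceil : μ ^ 2 ≤ q1 * N + q0 := by
      have := (div_le_iff₀ hq1pos).1 (Int.le_ceil ((μ ^ 2 - q0) / q1))
      rw [← hN] at this
      linarith
    rw [hneg, mulVec_neg, WithLp.toLp_neg, norm_neg]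
    exact (pow_le_pow_left₀ (norm_nonneg _) hz 2).trans hceil
  refine ⟨⟨_, hmem, fun i => ⟨z i, rfl⟩, N, rfl⟩, ?_, ?_⟩
  · have hint : sInf {t : ℝ | ∃ p ∈ S, ((∀ i, ∃ zi : ℤ, p.1 i = (zi : ℝ)) ∧
        (∃ zn : ℤ, p.2 = (zn : ℝ))) ∧ t = p.2} ≤ N := by
      refine csInf_le ⟨-(q0 / q1), ?_⟩ ⟨_, hmem, ⟨fun i => ⟨z i, rfl⟩, N, rfl⟩, rfl⟩
      rintro t ⟨p, hp, -, rfl⟩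
      exact lower_bound p hp
    have hreal : -(q0 / q1) ≤ sInf {t : ℝ | ∃ p ∈ S, t = p.2} := by
      refine le_csInf ⟨_, _, hmem, rfl⟩ ?_
      rintro t ⟨p, hp, rfl⟩
      exact lower_bound p hp
    linarith
  · have := Int.ceil_lt_add_one ((μ ^ 2 - q0) / q1)
    rw [← hN, sub_div] at this
    linarith
end

section
/- Let n ≥ 2. Let M be a real symmetric n×n matrix written in block form M = [[M̄, a],[aᵀ, a₀]] with M̄ of size (n−1)×(n−1), a ∈ ℝ^{n−1}, a₀ ∈ ℝ, and write β = (β̄, βₙ) ∈ ℝ^{n−1} × ℝ, γ ∈ ℝ. Assume M̄ = Q̄ᵀQ̄ for an invertible (n−1)×(n−1) real matrix Q̄, and set q₂ := aᵀM̄⁻¹a − a₀, q₁ := 2(βₙ − β̄ᵀM̄⁻¹a), q₀ := β̄ᵀM̄⁻¹β̄ − γ. Let μ > 0 satisfy: for every y ∈ ℝ^{n−1} there exists z ∈ ℤ^{n−1} with ‖Q̄(y − z)‖₂ ≤ μ. Assume q₂ > 0 and q₁² − 4q₂q₀ ≥ 0, define δ_inf := (−q₁ + √(q₁² − 4q₂q₀))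 / (2q₂), and let S = { x ∈ ℝⁿ : xᵀMx − 2βᵀx + γ ≤ 0 and xₙ ≥ δ_inf }. Then S ∩ ℤⁿ ≠ ∅ and inf { xₙ : x ∈ S ∩ ℤⁿ } − δ_inf ≤ ⌈ (−q₁ + √(q₁² − 4q₂(q₀ − μ²))) / (2q₂) ⌉ − δ_inf ≤ μ/√q₂ + 1. -/
open Matrix

theorem Matrix.IsSymm.dotProduct_mulVec_comm_s16 {m : Type*} [Fintype m] {A : Matrix m m ℝ}
    (hA : A.IsSymm) (u v : m → ℝ) : u ⬝ᵥ A *ᵥ v = v ⬝ᵥ A *ᵥ u := by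
  rw [dotProduct_comm, ← vecMul_transpose, hA.eq, dotProduct_mulVec]

theorem norm_toLp_sq_eq_dotProduct {m : Type*} [Fintype m] (v : m → ℝ) :
    ‖WithLp.toLp 2 v‖ ^ 2 = v ⬝ᵥ v := by
  simp [EuclideanSpace.real_norm_sq_eq, dotProduct, ← sq]

/-- Completing the square in a quadratic form with linear term `2 * (c ⬝ᵥ z)`. -/
theorem Matrix.IsSymm.dotProduct_mulVec_sub_inv {m : Type*} [Fintype m] [DecidableEq m]
    {A : Matrix m m ℝ} (hA : A.IsSymm) (hdet : IsUnit A.det) (c z : m → ℝ) :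
    (-(A⁻¹ *ᵥ c) - z) ⬝ᵥ A *ᵥ (-(A⁻¹ *ᵥ c) - z) =
      z ⬝ᵥ A *ᵥ z + 2 * (c ⬝ᵥ z) + c ⬝ᵥ A⁻¹ *ᵥ c := by
  have h : A *ᵥ (A⁻¹ *ᵥ c) = c := by
    rw [mulVec_mulVec, mul_nonsing_inv _ hdet, one_mulVec]
  have h₁ : (A⁻¹ *ᵥ c) ⬝ᵥ A *ᵥ z = c ⬝ᵥ z := by
    rw [hA.dotProduct_mulVec_comm_s16, h, dotProduct_comm]
  simp only [mulVec_sub, mulVec_neg, h, sub_dotProduct, dotProduct_sub, neg_dotProduct,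
    dotProduct_neg, h₁, dotProduct_comm z c, dotProduct_comm (A⁻¹ *ᵥ c) c]
  ring

/-- A quadratic with positive leading coefficient is nonnegative beyond its largest root. -/
theorem quadratic_nonneg_of_root_le {a b c x : ℝ} (ha : 0 < a) (hd : 0 ≤ b ^ 2 - 4 * a * c)
    (hx : (-b + Real.sqrt (b ^ 2 - 4 * a * c)) / (2 * a) ≤ x) :
    0 ≤ a * x ^ 2 + b * x + c := by
  rw [div_le_iff₀ (by positivity)] at hx
  have hs := Real.sq_sqrt hd
  have h : Real.sqrt (b ^ 2 - 4 * a * c) ≤ 2 * a * x + b := by linarith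
  have h₂ := pow_le_pow_left₀ (Real.sqrt_nonneg _) h 2
  rw [hs] at h₂
  have h₃ : 0 ≤ 4 * a * (a * x ^ 2 + b * x + c) := by linarith
  exact nonneg_of_mul_nonneg_right h₃ (by positivity)

/-- hyperboloid-branch/translated-cone case `q₂ > 0`: integrality gap
bound for the objective `xₙ` over the branch `S` (defined by the blockwise quadratic
constraint together with `xₙ ≥ δ_inf`) of the quadratic set given by the block matrix
`M = [[M̄, a],[aᵀ, a₀]]`, `β = (β̄, βₙ)`, `γ`, where `ℝⁿ` is split as `ℝ^{n−1} × ℝ`. -/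
theorem stmt16 (n : ℕ) (hn : 2 ≤ n)
    (Mbar : Matrix (Fin (n - 1)) (Fin (n - 1)) ℝ) (hMbarSymm : Mbar.IsSymm)
    (a : Fin (n - 1) → ℝ) (a0 : ℝ)
    (βbar : Fin (n - 1) → ℝ) (βn : ℝ) (γ : ℝ)
    (Qbar : Matrix (Fin (n - 1)) (Fin (n - 1)) ℝ) (hQbarInv : IsUnit Qbar.det)
    (hMQ : Mbar = Qbarᵀ * Qbar)
    (q2 q1 q0 : ℝ)
    (hq2 : q2 = a ⬝ᵥ Mbar⁻¹.mulVec a - a0)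
    (hq1 : q1 = 2 * (βn - βbar ⬝ᵥ Mbar⁻¹.mulVec a))
    (hq0 : q0 = βbar ⬝ᵥ Mbar⁻¹.mulVec βbar - γ)
    (μ : ℝ) (hμpos : 0 < μ)
    (hμ : ∀ y : Fin (n - 1) → ℝ, ∃ z : Fin (n - 1) → ℤ,
      ‖(WithLp.equiv 2 (Fin (n - 1) → ℝ)).symm
        (Qbar.mulVec (y - fun i => (z i : ℝ)))‖ ≤ μ)
    (hq2pos : 0 < q2)
    (hdisc : 0 ≤ q1 ^ 2 - 4 * q2 * q0)
    (δinf : ℝ)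
    (hδinf : δinf = (-q1 + Real.sqrt (q1 ^ 2 - 4 * q2 * q0)) / (2 * q2))
    (S : Set (EuclideanSpace ℝ (Fin (n - 1)) × ℝ))
    (hS : S = {p : EuclideanSpace ℝ (Fin (n - 1)) × ℝ |
      p.1 ⬝ᵥ Mbar.mulVec p.1 + 2 * (a ⬝ᵥ p.1) * p.2 + a0 * p.2 ^ 2 -
        2 * (βbar ⬝ᵥ p.1 + βn * p.2) + γ ≤ 0 ∧ δinf ≤ p.2}) :
    (∃ p ∈ S, (∀ i, ∃ zi : ℤ, p.1 i = (zi : ℝ)) ∧ ∃ zn : ℤ, p.2 = (zn : ℝ)) ∧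
      sInf {t : ℝ | ∃ p ∈ S, ((∀ i, ∃ zi : ℤ, p.1 i = (zi : ℝ)) ∧
            (∃ zn : ℤ, p.2 = (zn : ℝ))) ∧ t = p.2} - δinf ≤
        (⌈(-q1 + Real.sqrt (q1 ^ 2 - 4 * q2 * (q0 - μ ^ 2))) / (2 * q2)⌉ : ℝ) - δinf ∧
      (⌈(-q1 + Real.sqrt (q1 ^ 2 - 4 * q2 * (q0 - μ ^ 2))) / (2 * q2)⌉ : ℝ) - δinf ≤
        μ / Real.sqrt q2 + 1 := by
  set ρ := (-q1 + Real.sqrt (q1 ^ 2 - 4 * q2 * (q0 - μ ^ 2))) / (2 * q2) with hρ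
  have hdisc' : q1 ^ 2 - 4 * q2 * (q0 - μ ^ 2) = (q1 ^ 2 - 4 * q2 * q0) + 4 * q2 * μ ^ 2 := by
    ring
  have hpos : 0 < 4 * q2 * μ ^ 2 := by positivity
  have hδρ : δinf ≤ ρ := by
    rw [hδinf, hρ, hdisc']
    gcongr
    linarith
  have hρδ : ρ - δinf ≤ μ / Real.sqrt q2 := by
    have hsqrt : Real.sqrt (4 * q2 * μ ^ 2) = 2 * Real.sqrt q2 * μ := by
      rw [show 4 * q2 * μ ^ 2 = q2 * (2 * μ) ^ 2 by ring, Real.sqrt_mul hq2pos.le,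
        Real.sqrt_sq (by positivity)]
      ring
    have hadd : Real.sqrt (q1 ^ 2 - 4 * q2 * q0 + 4 * q2 * μ ^ 2) ≤
        Real.sqrt (q1 ^ 2 - 4 * q2 * q0) + 2 * Real.sqrt q2 * μ := by
      refine Real.sqrt_le_iff.2 ⟨by positivity, ?_⟩
      rw [← hsqrt]
      nlinarith [Real.sq_sqrt hdisc, Real.sq_sqrt hpos.le,
        mul_nonneg (Real.sqrt_nonneg (q1 ^ 2 - 4 * q2 * q0)) (Real.sqrt_nonneg (4 * q2 * μ ^ 2))]
    have hs : 0 < Real.sqrt q2 := Real.sqrt_pos.2 hq2pos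
    have hμs : μ / Real.sqrt q2 = 2 * Real.sqrt q2 * μ / (2 * q2) := by
      rw [div_eq_div_iff hs.ne' (by positivity)]
      linear_combination (-2 * μ) * Real.mul_self_sqrt hq2pos.le
    rw [hδinf, hρ, hdisc', hμs, ← sub_div]
    gcongr
    linarith
  have hceil : ρ ≤ (⌈ρ⌉ : ℝ) := Int.le_ceil ρ
  obtain ⟨z, hz⟩ := hμ (-(Mbar⁻¹ *ᵥ ((⌈ρ⌉ : ℝ) • a - βbar)))
  have hdet : IsUnit Mbar.det := by
    rw [hMQ, det_mul, det_transpose]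
    exact hQbarInv.mul hQbarInv
  have hQ (w : Fin (n - 1) → ℝ) : ‖WithLp.toLp 2 (Qbar *ᵥ w)‖ ^ 2 = w ⬝ᵥ Mbar *ᵥ w := by
    rw [norm_toLp_sq_eq_dotProduct, hMQ, ← mulVec_mulVec, dotProduct_mulVec w, vecMul_transpose]
  have hsq := pow_le_pow_left₀ (norm_nonneg _) hz 2
  rw [WithLp.equiv_symm_apply, hQ, hMbarSymm.dotProduct_mulVec_sub_inv hdet] at hsq
  have hquad : 0 ≤ q2 * (⌈ρ⌉ : ℝ) ^ 2 + q1 * ⌈ρ⌉ + (q0 - μ ^ 2) :=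
    quadratic_nonneg_of_root_le hq2pos (by linarith) hceil
  have hinvSymm : Mbar⁻¹.IsSymm := hMbarSymm.inv
  simp only [mulVec_sub, mulVec_smul, sub_dotProduct, dotProduct_sub, smul_dotProduct,
    dotProduct_smul, smul_eq_mul, hinvSymm.dotProduct_mulVec_comm_s16 a βbar] at hsq
  have hmem : (WithLp.toLp 2 (fun i => (z i : ℝ)), (⌈ρ⌉ : ℝ)) ∈ S := by
    rw [hS]
    refine ⟨?_, hδρ.trans hceil⟩
    dsimp only
    rw [hq2, hq1, hq0] at hquad
    linarith
  refine ⟨⟨_, hmem, fun i => ⟨z i, rfl⟩, ⌈ρ⌉, rfl⟩, ?_, ?_⟩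
  · gcongr
    refine csInf_le ⟨δinf, ?_⟩ ⟨_, hmem, ⟨fun i => ⟨z i, rfl⟩, ⌈ρ⌉, rfl⟩, rfl⟩
    rintro t ⟨p, hp, -, rfl⟩
    rw [hS] at hp
    exact hp.2
  · linarith [Int.ceil_lt_add_one ρ]
end

section
/- Let ν > 0 and let κ satisfy κ > ν and κ > 1. Let P = { (a, b, c) ∈ ℝ³ : a > 0, b > 0, c > 0, a + b ≥ κ·c, a + b ≥ c + ν }, and define f(a, b, c) := (1/(2c)) · √( ((a+b)² − c²) · (c² − (a−b)²) ), where the square root of a negative real number is interpreted as 0. Then for every (a, b, c) ∈ P, f(a, b, c) − f(a, b, c + ν) ≤ (ν/2) · √( (κ+1)/(κ−1) ), and equality holds at the point a = b = κν/(2(κ−1)), c = ν/(κ−1), which belongs to P. Consequently the maximum of f(a,b,c) − f(a,b,c+ν) over P equals (ν/2)·√((κ+1)/(κ−1)). -/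
open Real

lemma half_height_eq {c : ℝ} (hc : 0 < c) {s d : ℝ} (hs : c ≤ s) :
    1 / (2 * c) * √((s ^ 2 - c ^ 2) * (c ^ 2 - d ^ 2)) =
      √(s ^ 2 - c ^ 2) * √(1 - (d / c) ^ 2) / 2 := by
  have hsc : 0 ≤ s ^ 2 - c ^ 2 := by nlinarith
  have hd : c ^ 2 - d ^ 2 = c ^ 2 * (1 - (d / c) ^ 2) := by field_simp
  rw [sqrt_mul hsc, hd, sqrt_mul (sq_nonneg c), sqrt_sq hc.le]
  field_simp

lemma half_height_sub_le {c ν s : ℝ} (hc : 0 < c) (hν : 0 < ν) (hs : c + ν ≤ s) (d : ℝ) :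
    1 / (2 * c) * √((s ^ 2 - c ^ 2) * (c ^ 2 - d ^ 2)) -
        1 / (2 * (c + ν)) * √((s ^ 2 - (c + ν) ^ 2) * ((c + ν) ^ 2 - d ^ 2)) ≤
      (√(s ^ 2 - c ^ 2) - √(s ^ 2 - (c + ν) ^ 2)) / 2 := by
  rw [half_height_eq hc (by linarith), half_height_eq (by linarith) hs]
  have hsqrt : √(s ^ 2 - (c + ν) ^ 2) ≤ √(s ^ 2 - c ^ 2) := sqrt_le_sqrt (by nlinarith)
  have hle_one : √(1 - (d / c) ^ 2) ≤ 1 :=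
    sqrt_le_one.mpr (by linarith [sq_nonneg (d / c)])
  have hmono : √(1 - (d / c) ^ 2) ≤ √(1 - (d / (c + ν)) ^ 2) := by
    apply sqrt_le_sqrt
    have : d ^ 2 / (c + ν) ^ 2 ≤ d ^ 2 / c ^ 2 := by gcongr; linarith
    rw [div_pow, div_pow]
    linarith
  nlinarith [mul_le_mul_of_nonneg_left hmono (sqrt_nonneg (s ^ 2 - (c + ν) ^ 2)),
    mul_nonneg (sub_nonneg.mpr hsqrt) (sub_nonneg.mpr hle_one)]

lemma sqrt_sub_sqrt_le {c ν κ s : ℝ} (hc : 0 < c) (hν : 0 < ν) (hκ : 1 < κ)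
    (hκs : κ * c ≤ s) (hs : c + ν ≤ s) :
    √(s ^ 2 - c ^ 2) - √(s ^ 2 - (c + ν) ^ 2) ≤ ν * √((κ + 1) / (κ - 1)) := by
  have hκ' : 0 < κ - 1 := by linarith
  set R := √((κ + 1) / (κ - 1)) with hR
  set Q := √(s ^ 2 - (c + ν) ^ 2) with hQ
  have hR0 : 0 ≤ R := sqrt_nonneg _
  have hQ0 : 0 ≤ Q := sqrt_nonneg _
  have hR2 : R ^ 2 * (κ - 1) = κ + 1 := by
    rw [hR, sq_sqrt (by positivity)]
    field_simp
  have hQ2 : Q ^ 2 = s ^ 2 - (c + ν) ^ 2 := sq_sqrt (by nlinarith)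
  have key : (κ - 1) * c - ν ≤ (κ - 1) * (R * Q) := by
    rcases le_total ((κ - 1) * c) ν with h | h
    · have : 0 ≤ (κ - 1) * (R * Q) := by positivity
      linarith
    · refine abs_le_of_sq_le_sq' ?_ (by positivity) |>.2
      have hlow : ((κ - 1) * c - ν) * ((κ + 1) * c + ν) ≤ Q ^ 2 := by
        have : 0 < κ * c := by positivity
        nlinarith
      have hsq : ((κ - 1) * (R * Q)) ^ 2 = (κ ^ 2 - 1) * Q ^ 2 := by
        linear_combination (κ - 1) * Q ^ 2 * hR2
      rw [hsq]
      have hx : 0 ≤ (κ - 1) * c - ν := by linarith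
      calc ((κ - 1) * c - ν) ^ 2
          ≤ (κ ^ 2 - 1) * (((κ - 1) * c - ν) * ((κ + 1) * c + ν)) := by
            have hfac : (κ - 1) * c - ν ≤ (κ ^ 2 - 1) * ((κ + 1) * c + ν) := by
              have h2 : (κ - 1) * c ≤ (κ - 1) * c * (κ + 1) ^ 2 :=
                le_mul_of_one_le_right (by positivity) (by nlinarith)
              have h3 : 0 ≤ (κ - 1) * (κ + 1) * ν := by positivity
              nlinarith
            nlinarith [mul_le_mul_of_nonneg_left hfac hx]
        _ ≤ (κ ^ 2 - 1) * Q ^ 2 := mul_le_mul_of_nonneg_left hlow (by nlinarith)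
  rw [sub_le_iff_le_add]
  refine sqrt_le_iff.mpr ⟨by positivity, ?_⟩
  have hexp : (κ - 1) * (s ^ 2 - c ^ 2) ≤ (κ - 1) * (ν * R + Q) ^ 2 := by
    have hsq : (κ - 1) * (ν * R + Q) ^ 2 = ν ^ 2 * (κ + 1) +
        2 * (ν * ((κ - 1) * (R * Q))) + (κ - 1) * (s ^ 2 - (c + ν) ^ 2) := by
      linear_combination ν ^ 2 * hR2 + (κ - 1) * hQ2
    rw [hsq]
    linarith [mul_le_mul_of_nonneg_left key hν.le]
  exact le_of_mul_le_mul_left hexp hκ'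

/-- For `ν > 0`, `κ > ν`, `κ > 1`, and
`f(a,b,c) = (1/(2c))·√(((a+b)²−c²)(c²−(a−b)²))` (with `√t = 0` for `t < 0`, as for
`Real.sqrt`), the quantity `f(a,b,c) − f(a,b,c+ν)` is at most `(ν/2)√((κ+1)/(κ−1))`
on `P = {(a,b,c) : a,b,c > 0, a+b ≥ κc, a+b ≥ c+ν}`, with equality at the point
`a = b = κν/(2(κ−1))`, `c = ν/(κ−1)` of `P`; hence the maximum over `P` equals
`(ν/2)√((κ+1)/(κ−1))`. -/
theorem stmt18 (ν κ : ℝ) (hν : 0 < ν) (hκν : ν < κ) (hκ1 : 1 < κ)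
    (f : ℝ → ℝ → ℝ → ℝ)
    (hf : ∀ a b c : ℝ, f a b c = 1 / (2 * c) *
      Real.sqrt (((a + b) ^ 2 - c ^ 2) * (c ^ 2 - (a - b) ^ 2))) :
    (∀ a b c : ℝ, 0 < a → 0 < b → 0 < c → κ * c ≤ a + b → c + ν ≤ a + b →
      f a b c - f a b (c + ν) ≤ ν / 2 * Real.sqrt ((κ + 1) / (κ - 1))) ∧
    (0 < κ * ν / (2 * (κ - 1)) ∧ 0 < ν / (κ - 1) ∧
      κ * (ν / (κ - 1)) ≤ κ * ν / (2 * (κ - 1)) + κ * ν / (2 * (κ - 1)) ∧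
      ν / (κ - 1) + ν ≤ κ * ν / (2 * (κ - 1)) + κ * ν / (2 * (κ - 1))) ∧
    f (κ * ν / (2 * (κ - 1))) (κ * ν / (2 * (κ - 1))) (ν / (κ - 1)) -
        f (κ * ν / (2 * (κ - 1))) (κ * ν / (2 * (κ - 1))) (ν / (κ - 1) + ν) =
      ν / 2 * Real.sqrt ((κ + 1) / (κ - 1)) ∧
    IsGreatest {t : ℝ | ∃ a b c : ℝ, 0 < a ∧ 0 < b ∧ 0 < c ∧ κ * c ≤ a + b ∧
        c + ν ≤ a + b ∧ t = f a b c - f a b (c + ν)}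
      (ν / 2 * Real.sqrt ((κ + 1) / (κ - 1))) := by
  have hκ' : 0 < κ - 1 := by linarith
  have hbound : ∀ a b c : ℝ, 0 < a → 0 < b → 0 < c → κ * c ≤ a + b → c + ν ≤ a + b →
      f a b c - f a b (c + ν) ≤ ν / 2 * √((κ + 1) / (κ - 1)) := by
    intro a b c _ _ hc hκs hs
    rw [hf, hf]
    linarith [half_height_sub_le hc hν hs (a - b), sqrt_sub_sqrt_le hc hν hκ1 hκs hs]
  have hsum : κ * ν / (2 * (κ - 1)) + κ * ν / (2 * (κ - 1)) = κ * (ν / (κ - 1)) := by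
    field_simp
    ring
  have hc_add : ν / (κ - 1) + ν = κ * (ν / (κ - 1)) := by
    field_simp
    ring
  have hmem : 0 < κ * ν / (2 * (κ - 1)) ∧ 0 < ν / (κ - 1) ∧
      κ * (ν / (κ - 1)) ≤ κ * ν / (2 * (κ - 1)) + κ * ν / (2 * (κ - 1)) ∧
      ν / (κ - 1) + ν ≤ κ * ν / (2 * (κ - 1)) + κ * ν / (2 * (κ - 1)) :=
    ⟨by positivity, by positivity, hsum.ge, (hc_add.trans hsum.symm).le⟩
  have heq : f (κ * ν / (2 * (κ - 1))) (κ * ν / (2 * (κ - 1))) (ν / (κ - 1)) -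
        f (κ * ν / (2 * (κ - 1))) (κ * ν / (2 * (κ - 1))) (ν / (κ - 1) + ν) =
      ν / 2 * √((κ + 1) / (κ - 1)) := by
    have hsq : (κ * (ν / (κ - 1))) ^ 2 - (ν / (κ - 1)) ^ 2 =
        ν ^ 2 * ((κ + 1) / (κ - 1)) := by
      field_simp
      ring
    rw [hf, hf, hsum, hc_add, half_height_eq hmem.2.1 (by nlinarith [hmem.2.1]), hsq,
      sqrt_mul (sq_nonneg ν), sqrt_sq hν.le]
    simp
    ring
  refine ⟨hbound, hmem, heq,
    ⟨_, _, _, hmem.1, hmem.1, hmem.2.1, hmem.2.2.1, hmem.2.2.2, heq.symm⟩, ?_⟩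
  rintro t ⟨a, b, c, ha, hb, hc, hκs, hs, rfl⟩
  exact hbound a b c ha hb hc hκs hs
end
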